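/- arXiv:1212.0506 — 2 statements merged into one kernel-verified Lean document; each statement's English description precedes it below -/
import Mathlib

section
/- Let n ∈ ℕ and let U be a unitary 2^n × 2^n complex matrix all of whose entries belong to the ring 𝔻[ω] = ℤ[1/√2, i]. Then there exists a matrix U′ in the Clifford+T group on n+1 qubits such that U′(v ⊗ e₀) = (Uv) ⊗ e₀ for all v ∈ ℂ^(2^n), where e₀ = (1,0)ᵀ ∈ ℂ² and ⊗ denotes the Kronecker product. (In particular, a single ancilla qubit, initialized and finalized in state |0⟩, suffices for exact Clifford+T synthesis.) -/
noncomputable section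

/-- The eighth root of unity `ω = e^{iπ/4} = (1+i)/√2`. -/
def ω : ℂ := (1 + Complex.I) / Real.sqrt 2

/-- A rational number is dyadic if it has the form `a / 2^n` with `a ∈ ℤ`, `n ∈ ℕ`. -/
def IsDyadic (q : ℚ) : Prop := ∃ (a : ℤ) (n : ℕ), q = a / 2 ^ n

/-- Membership in the ring `𝔻[ω] = ℤ[1/√2, i]`: complex numbers of the form
`aω³ + bω² + cω + d` with `a, b, c, d` dyadic rationals. -/
def inDω (t : ℂ) : Prop :=
  ∃ a b c d : ℚ, IsDyadic a ∧ IsDyadic b ∧ IsDyadic c ∧ IsDyadic d ∧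
    t = (a : ℂ) * ω ^ 3 + (b : ℂ) * ω ^ 2 + (c : ℂ) * ω + (d : ℂ)

/-- Membership in the ring `ℤ[ω]`: complex numbers of the form
`aω³ + bω² + cω + d` with `a, b, c, d ∈ ℤ`. -/
def inZω (t : ℂ) : Prop :=
  ∃ a b c d : ℤ, t = (a : ℂ) * ω ^ 3 + (b : ℂ) * ω ^ 2 + (c : ℂ) * ω + (d : ℂ)

/-- The Hadamard gate. -/
def Hmat : Matrix (Fin 2) (Fin 2) ℂ := ((Real.sqrt 2 : ℂ))⁻¹ • !![1, 1; 1, -1]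

/-- The phase gate `S`. -/
def Smat : Matrix (Fin 2) (Fin 2) ℂ := !![1, 0; 0, Complex.I]

/-- The `T` gate. -/
def Tmat : Matrix (Fin 2) (Fin 2) ℂ := !![1, 0; 0, ω]

/-- The `X` (not) gate. -/
def Xmat : Matrix (Fin 2) (Fin 2) ℂ := !![0, 1; 1, 0]

/-- The controlled-not gate, as a matrix on two qubits: it sends `|a,b⟩` to `|a, a+b⟩`. -/
def CNOTmat : Matrix (Fin 2 × Fin 2) (Fin 2 × Fin 2) ℂ :=
  Matrix.of fun p q => if p.1 = q.1 ∧ p.2 = q.1 + q.2 then 1 else 0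

/-- The operator obtained by applying the single-qubit gate `G` to the `j`-th of `n` qubits
(and the identity to the remaining factors); this is `P_σ⁻¹ (G ⊗ I) P_σ` written entrywise. -/
def app1 {n : ℕ} (G : Matrix (Fin 2) (Fin 2) ℂ) (j : Fin n) :
    Matrix (Fin n → Fin 2) (Fin n → Fin 2) ℂ :=
  Matrix.of fun x y => if ∀ i, i ≠ j → x i = y i then G (x j) (y j) else 0

/-- The operator obtained by applying the two-qubit gate `G` to the ordered pair `(j, l)` of
distinct qubits among `n` qubits (and the identity to the remaining factors). -/
def app2 {n : ℕ} (G : Matrix (Fin 2 × Fin 2) (Fin 2 × Fin 2) ℂ) (j l : Fin n) :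
    Matrix (Fin n → Fin 2) (Fin n → Fin 2) ℂ :=
  Matrix.of fun x y => if ∀ i, i ≠ j → i ≠ l → x i = y i then G (x j, x l) (y j, y l) else 0

/-- The Clifford+T group on `n` qubits: the subgroup of the unitary group on `(ℂ²)^{⊗n}`
generated by the scalar `ω`, the gates `H`, `S`, `T` applied to any single qubit, and
CNOT applied to any ordered pair of distinct qubits. -/
def CliffordT (n : ℕ) : Subgroup (Matrix.unitaryGroup (Fin n → Fin 2) ℂ) :=
  Subgroup.closure
    {U | (U : Matrix (Fin n → Fin 2) (Fin n → Fin 2) ℂ)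
            = ω • (1 : Matrix (Fin n → Fin 2) (Fin n → Fin 2) ℂ)
      ∨ (∃ j, (U : Matrix (Fin n → Fin 2) (Fin n → Fin 2) ℂ) = app1 Hmat j)
      ∨ (∃ j, (U : Matrix (Fin n → Fin 2) (Fin n → Fin 2) ℂ) = app1 Smat j)
      ∨ (∃ j, (U : Matrix (Fin n → Fin 2) (Fin n → Fin 2) ℂ) = app1 Tmat j)
      ∨ (∃ j l, j ≠ l ∧ (U : Matrix (Fin n → Fin 2) (Fin n → Fin 2) ℂ) = app2 CNOTmat j l)}

/-- The Kronecker (tensor) product of a vector on `n` qubits with a vector on `m` qubits. -/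
def tensorVec {n m : ℕ} (v : (Fin n → Fin 2) → ℂ) (w : (Fin m → Fin 2) → ℂ) :
    (Fin (n + m) → Fin 2) → ℂ :=
  fun x => v (fun i => x (Fin.castAdd m i)) * w (fun i => x (Fin.natAdd n i))

/-- The first standard basis vector `e₀ = |0⋯0⟩` of `ℂ^(2^m)`. -/
def e0 (m : ℕ) : (Fin m → Fin 2) → ℂ := fun x => if x = fun _ => 0 then 1 else 0

namespace CTSynth

open Matrix ComplexConjugate

/-! ### Number theory in `ℤ[ω]` -/

/-- The complex number `√2`. -/
def s2 : ℂ := (Real.sqrt 2 : ℝ)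

lemma s2_sq : s2 * s2 = 2 := by
  unfold s2
  rw [← Complex.ofReal_mul, Real.mul_self_sqrt (by norm_num)]
  norm_num

lemma s2_ne : s2 ≠ 0 := by
  intro h
  have := s2_sq
  rw [h] at this
  norm_num at this

lemma ω_eq : ω = (1 + Complex.I) / s2 := rfl

lemma ω_sq : ω ^ 2 = Complex.I := by
  rw [ω_eq, div_pow, pow_two s2, s2_sq, div_eq_iff (by norm_num)]
  linear_combination Complex.I_sq

lemma ω_four : ω ^ 4 = -1 := by
  have : ω ^ 4 = (ω ^ 2) ^ 2 := by ring
  rw [this, ω_sq, Complex.I_sq]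

lemma ω_ne : ω ≠ 0 := by
  intro h
  have := ω_four
  rw [h] at this
  norm_num at this

lemma s2_eq : s2 = ω - ω ^ 3 := by
  have h : ω * s2 = 1 + Complex.I := by rw [ω_eq, div_mul_cancel₀ _ s2_ne]
  have h2 : ω * s2 = ω * (ω - ω ^ 3) := by
    rw [h]
    linear_combination -ω_sq - (-1) * ω_four
  exact mul_left_cancel₀ ω_ne h2

lemma conj_s2 : conj s2 = s2 := Complex.conj_ofReal _

lemma conj_ω : conj ω = - ω ^ 3 := by
  have h : conj ω * s2 = 1 - Complex.I := by
    rw [ω_eq, map_div₀, conj_s2, div_mul_cancel₀ _ s2_ne]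
    simp [sub_eq_add_neg]
  have h2 : conj ω * s2 = (- ω ^ 3) * s2 := by
    rw [h, s2_eq, ← ω_sq]
    linear_combination (1 - ω ^ 2) * ω_four
  exact mul_right_cancel₀ s2_ne h2

lemma conj_ω_mul : conj ω * ω = 1 := by
  rw [conj_ω]
  linear_combination -ω_four

/-- the prime above `2` -/
def lam : ℂ := 1 - ω

lemma Z_int (k : ℤ) : inZω k := ⟨0, 0, 0, k, by simp⟩
lemma Z_zero : inZω 0 := by simpa using Z_int 0
lemma Z_one : inZω 1 := by simpa using Z_int 1
lemma Z_ω : inZω ω := ⟨0, 0, 1, 0, by simp⟩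

lemma Z_add {x y : ℂ} (hx : inZω x) (hy : inZω y) : inZω (x + y) := by
  obtain ⟨a, b, c, d, rfl⟩ := hx
  obtain ⟨a', b', c', d', rfl⟩ := hy
  exact ⟨a + a', b + b', c + c', d + d', by push_cast; ring⟩

lemma Z_neg {x : ℂ} (hx : inZω x) : inZω (-x) := by
  obtain ⟨a, b, c, d, rfl⟩ := hx
  exact ⟨-a, -b, -c, -d, by push_cast; ring⟩

lemma Z_sub {x y : ℂ} (hx : inZω x) (hy : inZω y) : inZω (x - y) := by
  rw [sub_eq_add_neg]; exact Z_add hx (Z_neg hy)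

lemma Z_mul {x y : ℂ} (hx : inZω x) (hy : inZω y) : inZω (x * y) := by
  obtain ⟨a, b, c, d, rfl⟩ := hx
  obtain ⟨a', b', c', d', rfl⟩ := hy
  refine ⟨a * d' + b * c' + c * b' + d * a', b * d' + c * c' + d * b' - a * a',
    c * d' + d * c' - a * b' - b * a', d * d' - a * c' - b * b' - c * a', ?_⟩
  push_cast
  linear_combination ((a : ℂ) * a' * ω ^ 2 + (a * b' + b * a') * ω + (a * c' + b * b' + c * a'))
    * ω_four

lemma Z_pow {x : ℂ} (hx : inZω x) (k : ℕ) : inZω (x ^ k) := by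
  induction k with
  | zero => simpa using Z_one
  | succ k ih => rw [pow_succ]; exact Z_mul ih hx

lemma Z_conj {x : ℂ} (hx : inZω x) : inZω (conj x) := by
  obtain ⟨a, b, c, d, rfl⟩ := hx
  refine ⟨-c, -b, -a, d, ?_⟩
  simp only [map_add, map_mul, map_pow, conj_ω, map_intCast]
  push_cast
  linear_combination (-(a : ℂ) * ω * (ω ^ 4 - 1) + b * ω ^ 2) * ω_four

lemma Z_s2 : inZω s2 := by rw [s2_eq]; exact Z_sub Z_ω (Z_pow Z_ω 3)

lemma Z_lam : inZω lam := Z_sub Z_one Z_ω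

lemma Z_two : inZω 2 := by simpa using Z_int 2

/-- Divisibility by `lam` in `ℤ[ω]`. -/
def Ev (x : ℂ) : Prop := ∃ y, inZω y ∧ x = lam * y

lemma Ev_add {x y : ℂ} (hx : Ev x) (hy : Ev y) : Ev (x + y) := by
  obtain ⟨a, ha, rfl⟩ := hx
  obtain ⟨b, hb, rfl⟩ := hy
  exact ⟨a + b, Z_add ha hb, by ring⟩

lemma Ev_mul {x y : ℂ} (hx : Ev x) (hy : inZω y) : Ev (x * y) := by
  obtain ⟨a, ha, rfl⟩ := hx
  exact ⟨a * y, Z_mul ha hy, by ring⟩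

lemma Ev_neg {x : ℂ} (hx : Ev x) : Ev (-x) := by
  obtain ⟨a, ha, rfl⟩ := hx
  exact ⟨-a, Z_neg ha, by ring⟩

lemma Ev_sub {x y : ℂ} (hx : Ev x) (hy : Ev y) : Ev (x - y) := by
  rw [sub_eq_add_neg]; exact Ev_add hx (Ev_neg hy)

lemma Ev_Z {x : ℂ} (hx : Ev x) : inZω x := by
  obtain ⟨a, ha, rfl⟩ := hx
  exact Z_mul Z_lam ha

lemma Ev_zero : Ev 0 := ⟨0, Z_zero, by simp⟩

lemma lam_ne : lam ≠ 0 := by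
  intro h
  have h1 : ω = 1 := by unfold lam at h; linear_combination -h
  have := ω_four
  rw [h1] at this
  norm_num at this

lemma Ev_two : Ev 2 :=
  ⟨1 + ω + ω ^ 2 + ω ^ 3, Z_add (Z_add (Z_add Z_one Z_ω) (Z_pow Z_ω 2)) (Z_pow Z_ω 3), by
    unfold lam; linear_combination ω_four⟩

lemma Ev_s2 : Ev s2 :=
  ⟨ω * (1 + ω), Z_mul Z_ω (Z_add Z_one Z_ω), by rw [s2_eq]; unfold lam; ring⟩

lemma Ev_or {x : ℂ} (hx : inZω x) : Ev x ∨ Ev (x - 1) := by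
  obtain ⟨a, b, c, d, rfl⟩ := hx
  have h1 : Ev ((a : ℂ) * ω ^ 3 + b * ω ^ 2 + c * ω + d - ((a + b + c + d : ℤ) : ℂ)) := by
    refine ⟨-(a * (1 + ω + ω ^ 2) + b * (1 + ω) + c), Z_neg (Z_add (Z_add (Z_mul (Z_int a)
      (Z_add (Z_add Z_one Z_ω) (Z_pow Z_ω 2))) (Z_mul (Z_int b) (Z_add Z_one Z_ω))) (Z_int c)), ?_⟩
    unfold lam; push_cast; ring
  rcases Int.even_or_odd' (a + b + c + d) with ⟨k, hk | hk⟩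
  · left
    have := Ev_add h1 (Ev_mul Ev_two (Z_int k))
    rw [hk] at this
    convert this using 1
    push_cast; ring
  · right
    have := Ev_add h1 (Ev_mul Ev_two (Z_int k))
    rw [hk] at this
    convert this using 1
    push_cast; ring

lemma int_sqrt2 (x y : ℤ) (h : (x : ℂ) + s2 * y = 0) : x = 0 := by
  have h' : (x : ℝ) + Real.sqrt 2 * y = 0 := by
    unfold s2 at h
    exact_mod_cast h
  by_contra hx
  have hy : y ≠ 0 := by
    rintro rfl
    simp at h'
    exact hx h'
  have hy' : (y : ℝ) ≠ 0 := by exact_mod_cast hy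
  apply irrational_sqrt_two
  refine ⟨-(x : ℚ) / y, ?_⟩
  push_cast
  rw [div_eq_iff hy']
  linarith

lemma normsq_eq (a b c d : ℤ) :
    conj ((a : ℂ) * ω ^ 3 + b * ω ^ 2 + c * ω + d) * ((a : ℂ) * ω ^ 3 + b * ω ^ 2 + c * ω + d)
      = ((a ^ 2 + b ^ 2 + c ^ 2 + d ^ 2 : ℤ) : ℂ) + s2 * ((a * b + b * c + c * d - d * a : ℤ) : ℂ) := by
  have h2 : conj ω ^ 2 = - ω ^ 2 := by
    rw [conj_ω]; linear_combination ω ^ 2 * ω_four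
  have h3 : conj ω ^ 3 = - ω := by
    rw [conj_ω]; linear_combination (-ω ^ 5 + ω) * ω_four
  simp only [map_add, map_mul, map_pow, map_intCast, h2, h3]
  rw [conj_ω, s2_eq]
  push_cast
  linear_combination (-((a : ℂ) ^ 2 + b ^ 2 + c ^ 2) - (b * c + a * b) * ω - a * c * ω ^ 2) * ω_four

lemma not_Ev_one : ¬ Ev 1 := by
  rintro ⟨y, hy, h⟩
  -- `1/2` would lie in `ℤ[ω]`, and then its norm square is `1/4`
  have hl : lam ^ 4 = 2 * (ω ^ 2 * (1 - s2) ^ 2) := by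
    rw [s2_eq]; unfold lam
    linear_combination (-2*ω^4 + 4*ω^2 - 4 * ω + 1) * ω_four
  have hz : inZω (ω ^ 2 * (1 - s2) ^ 2 * y ^ 4) :=
    Z_mul (Z_mul (Z_pow Z_ω 2) (Z_pow (Z_sub Z_one Z_s2) 2)) (Z_pow hy 4)
  have h1 : 2 * (ω ^ 2 * (1 - s2) ^ 2 * y ^ 4) = 1 := by
    have : (lam * y) ^ 4 = 1 := by rw [← h]; norm_num
    rw [mul_pow, hl] at this
    linear_combination this
  obtain ⟨a, b, c, d, he⟩ := hz
  have h2 := normsq_eq a b c d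
  rw [← he] at h2
  set z := ω ^ 2 * (1 - s2) ^ 2 * y ^ 4
  have hzz : z = 1 / 2 := by linear_combination h1 / 2
  rw [hzz] at h2
  have h3 := int_sqrt2 (4 * (a ^ 2 + b ^ 2 + c ^ 2 + d ^ 2) - 1) (4 * (a * b + b * c + c * d - d * a))
    (by
      have : conj (1 / 2 : ℂ) = 1 / 2 := by simp [Complex.conj_ofNat]
      rw [this] at h2
      push_cast at h2 ⊢
      linear_combination -4 * h2)
  omega

lemma odd_rep {a : ℂ} (ha : Ev (a - 1)) :
    ∃ m : ℕ, m ≤ 3 ∧ ∃ y, inZω y ∧ a - ω ^ m = lam ^ 3 * y := by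
  have h24 : ∃ t, inZω t ∧ 2 = lam ^ 2 * t := by
    obtain ⟨t, ht, e⟩ := Ev_s2
    refine ⟨t ^ 2, Z_pow ht 2, ?_⟩
    rw [← s2_sq, e]; ring
  obtain ⟨t, ht, e2⟩ := h24
  have hω : ω = 1 - lam := by unfold lam; ring
  obtain ⟨α, hα, e⟩ := ha
  have ea : a = 1 + lam * α := by linear_combination e
  rcases Ev_or hα with ⟨β, hβ, e'⟩ | ⟨β, hβ, e'⟩
  · rcases Ev_or hβ with ⟨γ, hγ, e''⟩ | ⟨γ, hγ, e''⟩
    · refine ⟨0, by norm_num, γ, hγ, ?_⟩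
      rw [ea, e', e'']; ring
    · refine ⟨2, by norm_num, γ + t, Z_add hγ ht, ?_⟩
      have : β = 1 + lam * γ := by linear_combination e''
      rw [ea, e', this, hω]
      linear_combination lam * e2
  · have e1 : α = 1 + lam * β := by linear_combination e'
    rcases Ev_or hβ with ⟨γ, hγ, e''⟩ | ⟨γ, hγ, e''⟩
    · refine ⟨1, by norm_num, γ + t, Z_add hγ ht, ?_⟩
      rw [ea, e1, e'', hω]
      linear_combination lam * e2
    · refine ⟨3, by norm_num, γ + (2 - lam) * t + 1,
        Z_add (Z_add hγ (Z_mul (Z_sub Z_two Z_lam) ht)) Z_one, ?_⟩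
      have : β = 1 + lam * γ := by linear_combination e''
      rw [ea, e1, this, hω]
      linear_combination (2 * lam - lam ^ 2) * e2

lemma ω_eight : ω ^ 8 = 1 := by
  have : ω ^ 8 = (ω ^ 4) ^ 2 := by ring
  rw [this, ω_four]; norm_num

lemma lam_sq : lam ^ 2 = s2 * (ω * (1 - s2)) := by
  have h : ω * s2 = 1 + ω ^ 2 := by rw [s2_eq]; linear_combination -ω_four
  unfold lam
  linear_combination -h - -ω * s2_sq

/-- The key reduction: two odd elements can be combined. -/
lemma combine {a b : ℂ} (ha : Ev (a - 1)) (hb : Ev (b - 1)) (hbZ : inZω b) :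
    ∃ m : ℕ, Ev ((a + ω ^ m * b) / s2) ∧ Ev ((a - ω ^ m * b) / s2) := by
  obtain ⟨k, hk, y, hy, e⟩ := odd_rep ha
  obtain ⟨l, hl, z, hz, e'⟩ := odd_rep hb
  have hs := s2_ne
  have h8 := ω_eight
  have hm : ω ^ (k + (8 - l)) * ω ^ l = ω ^ k := by
    rw [← pow_add, show k + (8 - l) + l = k + 8 by omega, pow_add, h8, mul_one]
  set m := k + (8 - l)
  have hd : a - ω ^ m * b = lam ^ 3 * (y - ω ^ m * z) := by
    linear_combination e - ω ^ m * e' - hm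
  have h1 : Ev ((a - ω ^ m * b) / s2) := by
    refine ⟨ω * (1 - s2) * (y - ω ^ m * z), Z_mul (Z_mul Z_ω (Z_sub Z_one Z_s2))
      (Z_sub hy (Z_mul (Z_pow Z_ω m) hz)), ?_⟩
    rw [hd, div_eq_iff hs]
    linear_combination lam * (y - ω ^ m * z) * lam_sq
  refine ⟨m, ?_, h1⟩
  have h2 : Ev (s2 * (ω ^ m * b)) := Ev_mul Ev_s2 (Z_mul (Z_pow Z_ω m) hbZ)
  have := Ev_add h1 h2
  convert this using 1
  field_simp
  linear_combination -(ω ^ m * b) * s2_sq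

/-- The ring `𝔻[ω]`, via denominators that are powers of `lam`. -/
def DD (t : ℂ) : Prop := ∃ e : ℕ, inZω (lam ^ e * t)

lemma DD_mono {t : ℂ} {e : ℕ} (h : inZω (lam ^ e * t)) (k : ℕ) (hk : e ≤ k) :
    inZω (lam ^ k * t) := by
  obtain ⟨r, rfl⟩ := Nat.exists_eq_add_of_le hk
  rw [pow_add, mul_comm (lam ^ e), mul_assoc]
  exact Z_mul (Z_pow Z_lam r) h

lemma DD_add {x y : ℂ} (hx : DD x) (hy : DD y) : DD (x + y) := by
  obtain ⟨e, he⟩ := hx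
  obtain ⟨f, hf⟩ := hy
  refine ⟨max e f, ?_⟩
  rw [mul_add]
  exact Z_add (DD_mono he _ (le_max_left _ _)) (DD_mono hf _ (le_max_right _ _))

lemma DD_mul {x y : ℂ} (hx : DD x) (hy : DD y) : DD (x * y) := by
  obtain ⟨e, he⟩ := hx
  obtain ⟨f, hf⟩ := hy
  refine ⟨e + f, ?_⟩
  have := Z_mul he hf
  convert this using 1
  ring

lemma DD_of_Z {x : ℂ} (hx : inZω x) : DD x := ⟨0, by simpa using hx⟩

lemma DD_s2inv : DD (s2⁻¹) := by
  refine ⟨2, ?_⟩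
  rw [lam_sq, mul_comm, ← mul_assoc, inv_mul_cancel₀ s2_ne, one_mul]
  exact Z_mul Z_ω (Z_sub Z_one Z_s2)

lemma DD_pow {x : ℂ} (hx : DD x) (k : ℕ) : DD (x ^ k) := by
  induction k with
  | zero => simpa using DD_of_Z Z_one
  | succ k ih => rw [pow_succ]; exact DD_mul ih hx

lemma DD_dyadic {q : ℚ} (hq : IsDyadic q) : DD (q : ℂ) := by
  obtain ⟨a, n, rfl⟩ := hq
  have : (((a : ℚ) / 2 ^ n : ℚ) : ℂ) = a * (s2⁻¹ * s2⁻¹) ^ n := by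
    rw [← mul_inv, s2_sq]
    push_cast
    rw [div_eq_mul_inv, inv_pow]
  rw [this]
  exact DD_mul (DD_of_Z (Z_int a)) (DD_pow (DD_mul DD_s2inv DD_s2inv) n)

lemma DD_of_inD {t : ℂ} (h : inDω t) : DD t := by
  obtain ⟨a, b, c, d, ha, hb, hc, hd, rfl⟩ := h
  have hω := DD_of_Z Z_ω
  exact DD_add (DD_add (DD_add (DD_mul (DD_dyadic ha) (DD_pow hω 3))
    (DD_mul (DD_dyadic hb) (DD_pow hω 2))) (DD_mul (DD_dyadic hc) hω)) (DD_dyadic hd)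

/-! ### Two-level operators -/

section TwoLevel

set_option linter.unusedSectionVars false

variable {ι : Type} [Fintype ι] [DecidableEq ι]

/-- two-level Hadamard -/
def tlH (p q : ι) (v : ι → ℂ) : ι → ℂ := fun x =>
  if x = p then (v p + v q) / s2 else if x = q then (v p - v q) / s2 else v x

/-- one-level phase -/
def ph (p : ι) (v : ι → ℂ) : ι → ℂ := fun x => if x = p then ω * v x else v x

/-- transposition of two basis vectors -/
def sw (p q : ι) (v : ι → ℂ) : ι → ℂ := fun x => v (Equiv.swap p q x)

/-- Compositions of elementary operators acting outside of `S`. -/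
inductive Circ (S : Finset ι) : ((ι → ℂ) → (ι → ℂ)) → Prop
  | nil : Circ S (fun v => v)
  | H (p q : ι) (f : (ι → ℂ) → (ι → ℂ)) (hp : p ∉ S) (hq : q ∉ S) (hpq : p ≠ q) (hf : Circ S f) :
      Circ S (fun v => tlH p q (f v))
  | T (p : ι) (f : (ι → ℂ) → (ι → ℂ)) (hp : p ∉ S) (hf : Circ S f) : Circ S (fun v => ph p (f v))
  | X (p q : ι) (f : (ι → ℂ) → (ι → ℂ)) (hp : p ∉ S) (hq : q ∉ S) (hf : Circ S f) :
      Circ S (fun v => sw p q (f v))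

lemma Circ.comp {S : Finset ι} {f g : (ι → ℂ) → (ι → ℂ)} (hf : Circ S f) (hg : Circ S g) :
    Circ S (fun v => f (g v)) := by
  induction hf with
  | nil => exact hg
  | H p q f hp hq hpq hf ih => exact Circ.H p q _ hp hq hpq ih
  | T p f hp hf ih => exact Circ.T p _ hp ih
  | X p q f hp hq hf ih => exact Circ.X p q _ hp hq ih

lemma Circ.mono {S S' : Finset ι} (h : S' ⊆ S) {f : (ι → ℂ) → (ι → ℂ)} (hf : Circ S f) :
    Circ S' f := by
  induction hf with
  | nil => exact Circ.nil
  | H p q f hp hq hpq hf ih => exact Circ.H p q _ (fun a => hp (h a)) (fun a => hq (h a)) hpq ih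
  | T p f hp hf ih => exact Circ.T p _ (fun a => hp (h a)) ih
  | X p q f hp hq hf ih => exact Circ.X p q _ (fun a => hp (h a)) (fun a => hq (h a)) ih

lemma sum_two {p q : ι} (hpq : p ≠ q) (f g : ι → ℂ) (h : ∀ i, i ≠ p → i ≠ q → f i = g i)
    (h2 : f p + f q = g p + g q) : ∑ i, f i = ∑ i, g i := by
  have key : ∀ k : ι → ℂ, ∑ i, k i = k p + k q + ∑ i ∈ (Finset.univ.erase p).erase q, k i := by
    intro k
    rw [← Finset.add_sum_erase _ k (Finset.mem_univ p),
      ← Finset.add_sum_erase (Finset.univ.erase p) k (a := q) (by simp [hpq.symm])]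
    ring
  rw [key f, key g, h2]
  congr 1
  apply Finset.sum_congr rfl
  intro i hi
  simp only [Finset.mem_erase, Finset.mem_univ, and_true] at hi
  exact h i hi.2 hi.1

/-- the hermitian inner product -/
def ip (u v : ι → ℂ) : ℂ := ∑ i, conj (u i) * v i

lemma ip_tlH {p q : ι} (hpq : p ≠ q) (u v : ι → ℂ) : ip (tlH p q u) (tlH p q v) = ip u v := by
  apply sum_two hpq
  · intro i h1 h2
    simp [tlH, h1, h2]
  · have hs := s2_ne
    simp only [tlH, if_true, hpq.symm, if_false, map_div₀, map_add, map_sub, conj_s2]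
    field_simp
    linear_combination -(conj (u p) * v p + conj (u q) * v q) * s2_sq

lemma ip_ph (p : ι) (u v : ι → ℂ) : ip (ph p u) (ph p v) = ip u v := by
  apply Finset.sum_congr rfl
  intro i _
  by_cases h : i = p
  · simp only [ph, h, if_true, map_mul]
    linear_combination (conj (u p) * v p) * conj_ω_mul
  · simp [ph, h]

lemma ip_sw (p q : ι) (u v : ι → ℂ) : ip (sw p q u) (sw p q v) = ip u v :=
  Equiv.sum_comp (Equiv.swap p q) (fun i => conj (u i) * v i)

lemma Circ.ip {S : Finset ι} {f : (ι → ℂ) → (ι → ℂ)} (hf : Circ S f) (u v : ι → ℂ) :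
    ip (f u) (f v) = ip u v := by
  induction hf with
  | nil => rfl
  | H p q f hp hq hpq hf ih => rw [ip_tlH hpq, ih]
  | T p f hp hf ih => rw [ip_ph, ih]
  | X p q f hp hq hf ih => rw [ip_sw, ih]

lemma Circ.zero {S : Finset ι} {f : (ι → ℂ) → (ι → ℂ)} (hf : Circ S f) (u : ι → ℂ) (s : ι)
    (hs : s ∈ S) : f u s = u s := by
  have key : ∀ p : ι, p ∉ S → s ≠ p := by rintro p hp rfl; exact hp hs
  induction hf with
  | nil => rfl
  | H p q f hp hq hpq hf ih => simp [tlH, key p hp, key q hq, ih]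
  | T p f hp hf ih => simp [ph, key p hp, ih]
  | X p q f hp hq hf ih => simp [sw, Equiv.swap_apply_of_ne_of_ne (key p hp) (key q hq), ih]

lemma Circ.fix {S : Finset ι} {f : (ι → ℂ) → (ι → ℂ)} (hf : Circ S f) (s : ι)
    (hs : s ∈ S) : f (Pi.single s 1) = Pi.single s 1 := by
  have key : ∀ p : ι, p ∉ S → p ≠ s := by rintro p hp rfl; exact hp hs
  induction hf with
  | nil => rfl
  | H p q f hp hq hpq hf ih =>
    simp only [ih]
    ext x
    by_cases h1 : x = p
    · subst h1; simp [tlH, key x hp, key q hq]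
    · by_cases h2 : x = q
      · subst h2; simp [tlH, key x hq, key p hp]
      · simp [tlH, h1, h2]
  | T p f hp hf ih =>
    simp only [ih]
    ext x
    by_cases h1 : x = p
    · subst h1; simp [ph, key x hp]
    · simp [ph, h1]
  | X p q f hp hq hf ih =>
    simp only [ih]
    ext x
    by_cases h1 : x = p
    · subst h1; simp [sw, key x hp, key q hq]
    · by_cases h2 : x = q
      · subst h2; simp [sw, key x hq, key p hp]
      · simp [sw, Equiv.swap_apply_of_ne_of_ne h1 h2]

lemma Circ.DD {S : Finset ι} {f : (ι → ℂ) → (ι → ℂ)} (hf : Circ S f) (u : ι → ℂ)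
    (hu : ∀ i, DD (u i)) (i : ι) : DD (f u i) := by
  induction hf generalizing i with
  | nil => exact hu i
  | H p q f hp hq hpq hf ih =>
    simp only [tlH]
    split_ifs
    · rw [div_eq_mul_inv]; exact DD_mul (DD_add (ih p) (ih q)) DD_s2inv
    · rw [div_eq_mul_inv, sub_eq_add_neg, neg_eq_neg_one_mul]
      refine DD_mul (DD_add (ih p) (DD_mul (DD_of_Z (Z_neg Z_one)) (ih q))) DD_s2inv
    · exact ih i
  | T p f hp hf ih =>
    simp only [ph]
    split_ifs
    · exact DD_mul (DD_of_Z Z_ω) (ih i)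
    · exact ih i
  | X p q f hp hq hf ih => exact ih _

/-- iterated phase -/
lemma circ_phase (S : Finset ι) (p : ι) (hp : p ∉ S) (m : ℕ) :
    Circ S (fun v x => if x = p then ω ^ m * v x else v x) := by
  induction m with
  | zero => simpa using Circ.nil (S := S)
  | succ m ih =>
    have := Circ.T p _ hp ih
    convert this using 1
    funext v x
    by_cases h : x = p
    · simp only [ph, h, if_true]; ring
    · simp [ph, h]

lemma Ev_sum (t : Finset ι) (f : ι → ℂ) (h : ∀ i ∈ t, Ev (f i)) : Ev (∑ i ∈ t, f i) :=
  Finset.sum_induction f Ev (fun _ _ => Ev_add) Ev_zero h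

lemma lower (S : Finset ι) (e : ℕ) : ∀ (N : ℕ) (u : ι → ℂ), (∀ s ∈ S, u s = 0) → ip u u = 1 →
    (∀ i, inZω (lam ^ (e + 1) * u i)) →
    (Set.ncard {i | ¬ Ev (lam ^ (e + 1) * u i)} ≤ N) →
    ∃ f, Circ S f ∧ ∀ i, inZω (lam ^ e * f u i) := by
  intro N
  induction N with
  | zero =>
    intro u hS h1 hZ hN
    have h0 : {i | ¬ Ev (lam ^ (e + 1) * u i)} = ∅ := by
      rw [← Set.ncard_eq_zero]; omega
    refine ⟨_, Circ.nil, fun i => ?_⟩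
    have : Ev (lam ^ (e + 1) * u i) := by
      by_contra hc
      have : i ∈ {i | ¬ Ev (lam ^ (e + 1) * u i)} := hc
      rw [h0] at this
      exact this
    obtain ⟨y, hy, he⟩ := this
    have : lam ^ e * u i = y := by
      apply mul_left_cancel₀ lam_ne
      rw [← he]; ring
    rw [this]; exact hy
  | succ N IH =>
    intro u hS h1 hZ hN
    by_cases hall : ∀ i, Ev (lam ^ (e + 1) * u i)
    · exact IH u hS h1 hZ (by simp [hall])
    push Not at hall
    obtain ⟨p, hp⟩ := hall
    have hex : ∃ q, q ≠ p ∧ ¬ Ev (lam ^ (e + 1) * u q) := by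
      by_contra hc
      push Not at hc
      have hsum : ∑ i, conj (lam ^ (e + 1) * u i) * (lam ^ (e + 1) * u i)
          = conj (lam ^ (e + 1)) * lam ^ (e + 1) := by
        have : ∑ i, conj (lam ^ (e + 1) * u i) * (lam ^ (e + 1) * u i)
          = conj (lam ^ (e + 1)) * lam ^ (e + 1) * ip u u := by
          rw [CTSynth.ip, Finset.mul_sum]
          apply Finset.sum_congr rfl
          intro i _
          rw [map_mul]; ring
        rw [this, h1, mul_one]
      rw [← Finset.add_sum_erase _ _ (Finset.mem_univ p)] at hsum
      have hE1 : Ev (∑ i ∈ Finset.univ.erase p,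
          conj (lam ^ (e + 1) * u i) * (lam ^ (e + 1) * u i)) := by
        apply Ev_sum
        intro i hi
        rw [mul_comm]
        exact Ev_mul (hc i (Finset.ne_of_mem_erase hi)) (Z_conj (hZ i))
      have hE2 : Ev (conj (lam ^ (e + 1)) * lam ^ (e + 1)) := by
        refine ⟨conj (lam ^ (e + 1)) * lam ^ e, Z_mul (Z_conj (Z_pow Z_lam _)) (Z_pow Z_lam _), ?_⟩
        ring
      have hE3 := Ev_sub hE2 hE1
      rw [← hsum, add_sub_cancel_right] at hE3
      rcases Ev_or (hZ p) with h | h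
      · exact hp h
      · have h4 := Ev_sub hE3 (Ev_mul h (Z_conj (hZ p)))
        have h5 : Ev (conj (lam ^ (e + 1) * u p)) := by
          convert h4 using 1
          ring
        rcases Ev_or (Z_conj (hZ p)) with h6 | h6
        · obtain ⟨y, hy, hy'⟩ := h5
          have h7 : lam ^ (e + 1) * u p = conj lam * conj y := by
            rw [← map_mul, ← hy', Complex.conj_conj]
          have h8 : conj lam = lam * (-conj ω) := by
            unfold lam
            rw [map_sub, map_one]
            linear_combination -conj_ω_mul
          apply hp
          refine ⟨-conj ω * conj y, Z_mul (Z_neg (Z_conj Z_ω)) (Z_conj hy), ?_⟩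
          rw [h7, h8]; ring
        · apply not_Ev_one
          have := Ev_sub h5 h6
          convert this using 1
          ring
    obtain ⟨q, hqp, hq⟩ := hex
    have hpS : p ∉ S := fun h => hp (by rw [hS p h, mul_zero]; exact Ev_zero)
    have hqS : q ∉ S := fun h => hq (by rw [hS q h, mul_zero]; exact Ev_zero)
    obtain ⟨m, hm1, hm2⟩ := combine ((Ev_or (hZ p)).resolve_left hp)
      ((Ev_or (hZ q)).resolve_left hq) (hZ q)
    have hc := Circ.H p q _ hpS hqS hqp.symm (circ_phase S q hqS m)
    set g : (ι → ℂ) → (ι → ℂ) :=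
      fun v => tlH p q (fun x => if x = q then ω ^ m * v x else v x) with hg
    have hgp : Ev (lam ^ (e + 1) * g u p) := by
      convert hm1 using 1
      simp only [hg, tlH, if_true, hqp.symm, if_false]
      ring
    have hgq : Ev (lam ^ (e + 1) * g u q) := by
      convert hm2 using 1
      simp only [hg, tlH, if_true, hqp, hqp.symm, if_false]
      ring
    have hgi : ∀ i, i ≠ p → i ≠ q → g u i = u i := by
      intro i h1 h2
      simp [hg, tlH, h1, h2]
    have hZ' : ∀ i, inZω (lam ^ (e + 1) * g u i) := by
      intro i
      by_cases h1 : i = p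
      · rw [h1]; exact Ev_Z hgp
      · by_cases h2 : i = q
        · rw [h2]; exact Ev_Z hgq
        · rw [hgi i h1 h2]; exact hZ i
    obtain ⟨f, hf, hfu⟩ := IH (g u) (fun s hs => by rw [hc.zero u s hs, hS s hs])
      (by rw [hc.ip, h1]) hZ' (by
        have hlt : Set.ncard {i | ¬ Ev (lam ^ (e + 1) * g u i)}
            < Set.ncard {i | ¬ Ev (lam ^ (e + 1) * u i)} := by
          apply Set.ncard_lt_ncard _ (Set.toFinite _)
          refine ⟨?_, ?_⟩
          · intro i hi
            have hi' : ¬ Ev (lam ^ (e + 1) * g u i) := hi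
            have h1 : i ≠ p := by rintro rfl; exact hi' hgp
            have h2 : i ≠ q := by rintro rfl; exact hi' hgq
            rw [hgi i h1 h2] at hi'
            exact hi'
          · intro hsub
            exact hsub (show p ∈ {i | ¬ Ev (lam ^ (e + 1) * u i)} from hp) hgp
        omega)
    exact ⟨_, hf.comp hc, hfu⟩

lemma unit_case (a b c d : ℤ) (h : a ^ 2 + b ^ 2 + c ^ 2 + d ^ 2 = 1) :
    ∃ m : ℕ, ω ^ m * ((a : ℂ) * ω ^ 3 + b * ω ^ 2 + c * ω + d) = 1 := by
  have bd : ∀ x y : ℤ, x ^ 2 + y = 1 → 0 ≤ y → x = 0 ∨ (x = 1 ∧ y = 0) ∨ (x = -1 ∧ y = 0) := by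
    intro x y h hy
    have h1 : x ≤ 1 := by nlinarith
    have h2 : -1 ≤ x := by nlinarith
    interval_cases x <;> omega
  have sq0 : ∀ x y : ℤ, x ^ 2 + y = 0 → 0 ≤ y → x = 0 ∧ y = 0 := by
    intro x y h hy
    have h1 : x ^ 2 = 0 := by nlinarith [sq_nonneg x]
    exact ⟨by simpa using h1, by omega⟩
  have h4 := ω_four
  have h8 := ω_eight
  rcases bd a (b ^ 2 + (c ^ 2 + d ^ 2)) (by linarith) (by positivity) with ha | ⟨ha, h0⟩ | ⟨ha, h0⟩
  · subst ha
    rcases bd b (c ^ 2 + d ^ 2) (by linarith) (by positivity) with hb | ⟨hb, h0⟩ | ⟨hb, h0⟩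
    · subst hb
      rcases bd c (d ^ 2) (by linarith) (by positivity) with hc | ⟨hc, h0⟩ | ⟨hc, h0⟩
      · subst hc
        rcases bd d 0 (by linarith) le_rfl with hd | ⟨hd, h0⟩ | ⟨hd, h0⟩
        · subst hd; norm_num at h
        · subst hd; exact ⟨0, by simp⟩
        · subst hd; exact ⟨4, by push_cast; linear_combination -h4⟩
      · have hd : d = 0 := by simpa using h0
        subst hc hd; exact ⟨7, by push_cast; linear_combination h8⟩
      · have hd : d = 0 := by simpa using h0
        subst hc hd; exact ⟨3, by push_cast; linear_combination -h4⟩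
    · obtain ⟨hc, hd⟩ := sq0 c _ h0 (by positivity)
      have hd : d = 0 := by simpa using hd
      subst hb hc hd; exact ⟨6, by push_cast; linear_combination h8⟩
    · obtain ⟨hc, hd⟩ := sq0 c _ h0 (by positivity)
      have hd : d = 0 := by simpa using hd
      subst hb hc hd; exact ⟨2, by push_cast; linear_combination -h4⟩
  · obtain ⟨hb, h0⟩ := sq0 b _ h0 (by positivity)
    obtain ⟨hc, hd⟩ := sq0 c _ h0 (by positivity)
    have hd : d = 0 := by simpa using hd
    subst ha hb hc hd; exact ⟨5, by push_cast; linear_combination h8⟩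
  · obtain ⟨hb, h0⟩ := sq0 b _ h0 (by positivity)
    obtain ⟨hc, hd⟩ := sq0 c _ h0 (by positivity)
    have hd : d = 0 := by simpa using hd
    subst ha hb hc hd; exact ⟨1, by push_cast; linear_combination -h4⟩

lemma terminal (S : Finset ι) (j : ι) (hj : j ∉ S) (u : ι → ℂ) (hS : ∀ s ∈ S, u s = 0)
    (h1 : ip u u = 1) (hZ : ∀ i, inZω (u i)) : ∃ f, Circ S f ∧ f u = Pi.single j 1 := by
  choose a b c d hu using hZ
  have hsum : ∑ i, (a i ^ 2 + b i ^ 2 + c i ^ 2 + d i ^ 2) = 1 := by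
    have h2 : ip u u = ((∑ i, (a i ^ 2 + b i ^ 2 + c i ^ 2 + d i ^ 2) : ℤ) : ℂ)
        + s2 * ((∑ i, (a i * b i + b i * c i + c i * d i - d i * a i) : ℤ) : ℂ) := by
      rw [ip, Int.cast_sum, Int.cast_sum, Finset.mul_sum, ← Finset.sum_add_distrib]
      apply Finset.sum_congr rfl
      intro i _
      rw [hu i, normsq_eq]
    rw [h1] at h2
    have := int_sqrt2 (∑ i, (a i ^ 2 + b i ^ 2 + c i ^ 2 + d i ^ 2) - 1)
      (∑ i, (a i * b i + b i * c i + c i * d i - d i * a i)) (by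
        rw [Int.cast_sub]
        rw [Int.cast_one]
        linear_combination -h2)
    linarith
  have hnn : ∀ i, 0 ≤ a i ^ 2 + b i ^ 2 + c i ^ 2 + d i ^ 2 := fun i => by positivity
  have hex : ∃ i, a i ^ 2 + b i ^ 2 + c i ^ 2 + d i ^ 2 ≠ 0 := by
    by_contra hc
    push Not at hc
    rw [Finset.sum_eq_zero (fun i _ => hc i)] at hsum
    norm_num at hsum
  obtain ⟨i, hi⟩ := hex
  have hsp := Finset.add_sum_erase Finset.univ
    (fun i => a i ^ 2 + b i ^ 2 + c i ^ 2 + d i ^ 2) (Finset.mem_univ i)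
  rw [hsum] at hsp
  have hrest : 0 ≤ ∑ k ∈ Finset.univ.erase i, (a k ^ 2 + b k ^ 2 + c k ^ 2 + d k ^ 2) :=
    Finset.sum_nonneg (fun k _ => hnn k)
  have hi1 : a i ^ 2 + b i ^ 2 + c i ^ 2 + d i ^ 2 = 1 := by
    have := hnn i
    omega
  have hr0 : ∑ k ∈ Finset.univ.erase i, (a k ^ 2 + b k ^ 2 + c k ^ 2 + d k ^ 2) = 0 := by
    omega
  have hz : ∀ k, k ≠ i → u k = 0 := by
    intro k hk
    have := (Finset.sum_eq_zero_iff_of_nonneg (fun k _ => hnn k)).1 hr0 k (by simp [hk])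
    have ha : a k = 0 := by nlinarith [sq_nonneg (a k), sq_nonneg (b k), sq_nonneg (c k), sq_nonneg (d k)]
    have hb : b k = 0 := by nlinarith [sq_nonneg (a k), sq_nonneg (b k), sq_nonneg (c k), sq_nonneg (d k)]
    have hc : c k = 0 := by nlinarith [sq_nonneg (a k), sq_nonneg (b k), sq_nonneg (c k), sq_nonneg (d k)]
    have hd : d k = 0 := by nlinarith [sq_nonneg (a k), sq_nonneg (b k), sq_nonneg (c k), sq_nonneg (d k)]
    rw [hu k, ha, hb, hc, hd]; simp
  obtain ⟨m, hm⟩ := unit_case _ _ _ _ hi1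
  rw [← hu i] at hm
  have hiS : i ∉ S := by
    intro h
    rw [hS i h] at hm
    simp at hm
  refine ⟨_, Circ.X i j _ hiS hj (circ_phase S i hiS m), ?_⟩
  ext x
  simp only [sw]
  by_cases hx : x = j
  · subst hx; simp [hm]
  · have h1 : Equiv.swap i j x ≠ i := by
      intro h
      apply hx
      have := congrArg (Equiv.swap i j) h
      simpa using this
    rw [if_neg h1, hz _ h1]
    simp [hx]

lemma column (S : Finset ι) (j : ι) (hj : j ∉ S) (e : ℕ) : ∀ (u : ι → ℂ) (_ : ∀ s ∈ S, u s = 0)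
    (_ : ip u u = 1) (_ : ∀ i, inZω (lam ^ e * u i)), ∃ f, Circ S f ∧ f u = Pi.single j 1 := by
  induction e with
  | zero =>
    intro u hS h1 hZ
    exact terminal S j hj u hS h1 (by simpa using hZ)
  | succ e ih =>
    intro u hS h1 hZ
    obtain ⟨f, hf, hfu⟩ := lower S e _ u hS h1 hZ le_rfl
    obtain ⟨g, hg, hgu⟩ := ih (f u) (fun s hs => by rw [hf.zero u s hs, hS s hs])
      (by rw [hf.ip, h1]) hfu
    exact ⟨_, hg.comp hf, hgu⟩

lemma ip_single (s : ι) (u : ι → ℂ) : ip (Pi.single s 1) u = u s := by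
  rw [ip, Finset.sum_eq_single s]
  · simp
  · intro b _ hb; simp [hb]
  · simp

lemma ip_unitary (U : Matrix ι ι ℂ) (hU : U ∈ Matrix.unitaryGroup ι ℂ) (u v : ι → ℂ) :
    ip (U *ᵥ u) (U *ᵥ v) = ip u v := by
  have h : ∀ u v : ι → ℂ, ip u v = star u ⬝ᵥ v := fun _ _ => rfl
  rw [h, h, Matrix.star_mulVec, ← Matrix.dotProduct_mulVec, Matrix.mulVec_mulVec]
  have : Uᴴ * U = 1 := Matrix.mem_unitaryGroup_iff'.1 hU
  rw [this, Matrix.one_mulVec]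

/-- Every unitary over `𝔻[ω]` is inverted by a sequence of one- and two-level operators. -/
theorem decompose (U : Matrix ι ι ℂ) (hU : U ∈ Matrix.unitaryGroup ι ℂ)
    (hent : ∀ i j, inDω (U i j)) : ∃ f, Circ (∅ : Finset ι) f ∧ ∀ v, f (U *ᵥ v) = v := by
  have key : ∀ S : Finset ι, ∃ f, Circ (∅ : Finset ι) f ∧
      ∀ s ∈ S, f (U *ᵥ Pi.single s 1) = Pi.single s 1 := by
    intro S
    induction S using Finset.induction_on with
    | empty => exact ⟨_, Circ.nil, by simp⟩
    | insert j S hj ih =>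
      obtain ⟨f, hf, hfs⟩ := ih
      have hD : ∀ i, DD (f (U *ᵥ Pi.single j 1) i) := by
        apply hf.DD
        intro i
        rw [Matrix.mulVec_single_one]
        exact DD_of_inD (hent i j)
      choose e he using hD
      obtain ⟨g, hg, hgu⟩ := column S j hj (Finset.univ.sup e) (f (U *ᵥ Pi.single j 1))
        (by
          intro s hs
          rw [← ip_single s (f (U *ᵥ Pi.single j 1)), ← hfs s hs, hf.ip, ip_unitary U hU, ip_single]
          have : s ≠ j := by rintro rfl; exact hj hs
          simp [this])
        (by rw [hf.ip, ip_unitary U hU, ip_single]; simp)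
        (fun i => DD_mono (he i) _ (Finset.le_sup (f := e) (Finset.mem_univ i)))
      refine ⟨_, (hg.mono (Finset.empty_subset S)).comp hf, ?_⟩
      intro s hs
      rcases Finset.mem_insert.1 hs with rfl | hs
      · exact hgu
      · rw [hfs s hs, hg.fix s hs]
  obtain ⟨f, hf, hfs⟩ := key Finset.univ
  refine ⟨f, hf, fun v => ?_⟩
  ext s
  rw [← ip_single s (f (U *ᵥ v)), ← hfs s (Finset.mem_univ s), hf.ip, ip_unitary U hU, ip_single]

end TwoLevel

/-! ### Clifford+T circuits -/

/-- The operator `f` is realised by a Clifford+T circuit. -/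
def CT {m : ℕ} (f : ((Fin m → Fin 2) → ℂ) → ((Fin m → Fin 2) → ℂ)) : Prop :=
  ∃ U' ∈ CliffordT m, ∀ v, (U' : Matrix (Fin m → Fin 2) (Fin m → Fin 2) ℂ) *ᵥ v = f v

lemma CT.comp {m : ℕ} {f g : ((Fin m → Fin 2) → ℂ) → ((Fin m → Fin 2) → ℂ)} (hf : CT f)
    (hg : CT g) : CT (fun v => f (g v)) := by
  obtain ⟨U, hU, hUf⟩ := hf
  obtain ⟨V, hV, hVg⟩ := hg
  refine ⟨U * V, mul_mem hU hV, fun v => ?_⟩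
  change _ = f (g v)
  rw [← hUf, ← hVg, Matrix.mulVec_mulVec]
  rfl

/-- A uniformly controlled single-qubit operator with target `j`. -/
def Op {m : ℕ} (j : Fin m) (F : (Fin m → Fin 2) → Matrix (Fin 2) (Fin 2) ℂ)
    (v : (Fin m → Fin 2) → ℂ) : (Fin m → Fin 2) → ℂ := fun x =>
  F x (x j) 0 * v (Function.update x j 0) + F x (x j) 1 * v (Function.update x j 1)

lemma Op_comp {m : ℕ} (j : Fin m) (F F' : (Fin m → Fin 2) → Matrix (Fin 2) (Fin 2) ℂ)
    (hF' : ∀ x b, F' (Function.update x j b) = F' x) (v : (Fin m → Fin 2) → ℂ) :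
    Op j F (Op j F' v) = Op j (fun x => F x * F' x) v := by
  funext x
  simp only [Op, hF', Function.update_self, Function.update_idem, Matrix.mul_apply,
    Fin.sum_univ_two]
  ring

lemma Op_one {m : ℕ} (j : Fin m) (v : (Fin m → Fin 2) → ℂ) : Op j (fun _ => 1) v = v := by
  funext x
  have hx := Function.update_eq_self j x
  rcases (by omega : x j = 0 ∨ x j = 1) with h | h
  · rw [h] at hx; simp [Op, h, hx, Matrix.one_apply]
  · rw [h] at hx; simp [Op, h, hx, Matrix.one_apply]

lemma app1_mulVec {m : ℕ} (G : Matrix (Fin 2) (Fin 2) ℂ) (j : Fin m) (v : (Fin m → Fin 2) → ℂ) :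
    app1 G j *ᵥ v = Op j (fun _ => G) v := by
  funext x
  have hne : Function.update x j 0 ≠ Function.update x j 1 := by
    intro h
    have := congrFun h j
    simp at this
  rw [Matrix.mulVec, dotProduct, Fintype.sum_eq_add _ _ hne]
  · have h : ∀ b : Fin 2, ∀ i, i ≠ j → x i = Function.update x j b i := by
      intro b i hi; simp [hi]
    simp only [app1, Matrix.of_apply, if_pos (h 0), if_pos (h 1), Op, Function.update_self]
  · rintro y ⟨h0, h1⟩
    have : ¬ ∀ i, i ≠ j → x i = y i := by
      intro h
      have hy : y = Function.update x j (y j) := by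
        funext i
        by_cases hi : i = j
        · subst hi; simp
        · simp [hi, h i hi]
      rcases (by omega : y j = 0 ∨ y j = 1) with h' | h'
      · rw [h'] at hy; exact h0 hy
      · rw [h'] at hy; exact h1 hy
    simp [app1, this]

lemma mat_ext {m : ℕ} {A B : Matrix (Fin m → Fin 2) (Fin m → Fin 2) ℂ}
    (h : ∀ v, A *ᵥ v = B *ᵥ v) : A = B :=
  Matrix.mulVec_injective (funext h)

lemma app1_unitary {m : ℕ} (G : Matrix (Fin 2) (Fin 2) ℂ) (j : Fin m) (hG : Gᴴ * G = 1) :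
    app1 G j ∈ Matrix.unitaryGroup (Fin m → Fin 2) ℂ := by
  rw [Matrix.mem_unitaryGroup_iff']
  have hs : star (app1 G j) = app1 Gᴴ j := by
    ext x y
    simp only [Matrix.star_eq_conjTranspose, Matrix.conjTranspose_apply, app1, Matrix.of_apply]
    by_cases h : ∀ i, i ≠ j → x i = y i
    · rw [if_pos h, if_pos (fun i hi => (h i hi).symm)]
    · rw [if_neg h, if_neg (fun h' => h (fun i hi => (h' i hi).symm)), star_zero]
  apply mat_ext
  intro v
  rw [hs, ← Matrix.mulVec_mulVec, app1_mulVec, app1_mulVec, Op_comp _ _ _ (fun _ _ => rfl), hG,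
    Op_one, Matrix.one_mulVec]

lemma cnot_mulVec {m : ℕ} (j l : Fin m) (hjl : j ≠ l) (v : (Fin m → Fin 2) → ℂ) :
    app2 CNOTmat j l *ᵥ v = fun x => v (Function.update x l (x j + x l)) := by
  funext x
  rw [Matrix.mulVec, dotProduct, Finset.sum_eq_single (Function.update x l (x j + x l))]
  · have h : ∀ i, i ≠ j → i ≠ l → x i = Function.update x l (x j + x l) i := by
      intro i _ hi; simp [hi]
    have h2 : x l = x j + (x j + x l) := by omega
    simp only [app2, Matrix.of_apply, if_pos h, CNOTmat, Function.update_self,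
      Function.update_of_ne hjl]
    rw [if_pos ⟨trivial, h2⟩, one_mul]
  · intro y _ hy
    by_cases h : ∀ i, i ≠ j → i ≠ l → x i = y i
    · have : ¬ (x j = y j ∧ x l = y j + y l) := by
        rintro ⟨h1, h2⟩
        apply hy
        funext i
        by_cases hi : i = l
        · subst hi
          simp only [Function.update_self]
          omega
        · by_cases hi' : i = j
          · subst hi'; simp [hi, h1]
          · simp [hi, h i hi' hi]
      simp [app2, CNOTmat, this]
    · simp [app2, h]
  · simp

lemma cnot_unitary {m : ℕ} (j l : Fin m) (hjl : j ≠ l) :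
    app2 CNOTmat j l ∈ Matrix.unitaryGroup (Fin m → Fin 2) ℂ := by
  rw [Matrix.mem_unitaryGroup_iff']
  have hs : star (app2 CNOTmat j l) = app2 CNOTmat j l := by
    ext x y
    simp only [Matrix.star_eq_conjTranspose, Matrix.conjTranspose_apply, app2, Matrix.of_apply,
      CNOTmat]
    by_cases h : ∀ i, i ≠ j → i ≠ l → x i = y i
    · rw [if_pos h, if_pos (fun i hi hi' => (h i hi hi').symm)]
      by_cases h2 : x j = y j ∧ x l = y j + y l
      · rw [if_pos h2, if_pos (by constructor <;> omega), star_one]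
      · rw [if_neg h2, if_neg (by omega), star_zero]
    · rw [if_neg h, if_neg (fun h' => h (fun i hi hi' => (h' i hi hi').symm)), star_zero]
  apply mat_ext
  intro v
  rw [hs, ← Matrix.mulVec_mulVec, cnot_mulVec j l hjl, cnot_mulVec j l hjl, Matrix.one_mulVec]
  funext x
  simp only [Function.update_idem, Function.update_self, Function.update_of_ne hjl]
  have : x j + (x j + x l) = x l := by omega
  rw [this, Function.update_eq_self]

/-- Clifford+T realisable uniformly controlled operators. -/
def CTF {m : ℕ} (j : Fin m) (F : (Fin m → Fin 2) → Matrix (Fin 2) (Fin 2) ℂ) : Prop :=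
  CT (Op j F) ∧ ∀ x b, F (Function.update x j b) = F x

lemma CTF.mul {m : ℕ} {j : Fin m} {F F' : (Fin m → Fin 2) → Matrix (Fin 2) (Fin 2) ℂ}
    (h : CTF j F) (h' : CTF j F') : CTF j (fun x => F x * F' x) := by
  refine ⟨?_, fun x b => by simp only [h.2, h'.2]⟩
  have := h.1.comp h'.1
  convert this using 1
  funext v
  rw [Op_comp _ _ _ h'.2]

lemma CTF_gate {m : ℕ} (j : Fin m) (G : Matrix (Fin 2) (Fin 2) ℂ) (hG : Gᴴ * G = 1)
    (h : G = Hmat ∨ G = Smat ∨ G = Tmat) : CTF j (fun _ => G) := by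
  refine ⟨⟨⟨app1 G j, app1_unitary G j hG⟩, ?_, fun v => app1_mulVec G j v⟩, fun _ _ => rfl⟩
  apply Subgroup.subset_closure
  rcases h with rfl | rfl | rfl
  · exact Or.inr (Or.inl ⟨j, rfl⟩)
  · exact Or.inr (Or.inr (Or.inl ⟨j, rfl⟩))
  · exact Or.inr (Or.inr (Or.inr (Or.inl ⟨j, rfl⟩)))

lemma Hmat_eq : Hmat = !![s2⁻¹, s2⁻¹; s2⁻¹, -s2⁻¹] := by
  ext i j
  fin_cases i <;> fin_cases j <;> simp [Hmat, s2]

lemma Smat_eq : Smat = !![1, 0; 0, ω ^ 2] := by rw [ω_sq]; rfl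

lemma s2inv_sq : s2⁻¹ * s2⁻¹ = 1 / 2 := by rw [← mul_inv, s2_sq]; norm_num

lemma one_eq2 : (1 : Matrix (Fin 2) (Fin 2) ℂ) = !![1, 0; 0, 1] := Matrix.one_fin_two

lemma CTF_H {m : ℕ} (j : Fin m) : CTF j (fun _ => Hmat) := by
  refine CTF_gate j _ ?_ (Or.inl rfl)
  have h := s2inv_sq
  rw [Hmat_eq, one_eq2]
  ext i j
  fin_cases i <;> fin_cases j <;>
    simp [Matrix.mul_apply, Fin.sum_univ_two, Matrix.conjTranspose_apply, conj_s2, h] <;> norm_num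

lemma CTF_S {m : ℕ} (j : Fin m) : CTF j (fun _ => Smat) := by
  refine CTF_gate j _ ?_ (Or.inr (Or.inl rfl))
  rw [one_eq2]
  ext i j
  fin_cases i <;> fin_cases j <;>
    simp [Smat, Matrix.mul_apply, Fin.sum_univ_two, Matrix.conjTranspose_apply]

lemma CTF_T {m : ℕ} (j : Fin m) : CTF j (fun _ => Tmat) := by
  refine CTF_gate j _ ?_ (Or.inr (Or.inr rfl))
  rw [one_eq2]
  ext i j
  fin_cases i <;> fin_cases j <;>
    simp [Tmat, Matrix.mul_apply, Fin.sum_univ_two, Matrix.conjTranspose_apply, conj_ω_mul]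

lemma CTF_ω {m : ℕ} (j : Fin m) : CTF j (fun _ => !![ω, 0; 0, ω]) := by
  refine ⟨⟨⟨ω • 1, ?_⟩, ?_, fun v => ?_⟩, fun _ _ => rfl⟩
  · rw [Matrix.mem_unitaryGroup_iff']
    simp [star_smul, smul_smul, mul_comm ω, conj_ω_mul]
  · apply Subgroup.subset_closure
    exact Or.inl rfl
  · rw [Matrix.smul_mulVec, Matrix.one_mulVec]
    funext x
    have hx := Function.update_eq_self j x
    rcases (by omega : x j = 0 ∨ x j = 1) with h | h
    · rw [h] at hx; simp [Op, h, hx]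
    · rw [h] at hx; simp [Op, h, hx]

lemma CTF_X {m : ℕ} (j : Fin m) : CTF j (fun _ => Xmat) := by
  have := (((CTF_H j).mul (CTF_S j)).mul (CTF_S j)).mul (CTF_H j)
  convert this using 2
  rw [Hmat_eq, Smat_eq, Xmat]
  have h := s2inv_sq
  have h4 := ω_four
  simp only [Matrix.mul_fin_two]
  ext i j
  fin_cases i <;> fin_cases j <;> simp
  · linear_combination -(s2⁻¹ * s2⁻¹) * h4
  · linear_combination (s2⁻¹ * s2⁻¹) * h4 - 2 * h
  · linear_combination (s2⁻¹ * s2⁻¹) * h4 - 2 * h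
  · linear_combination -(s2⁻¹ * s2⁻¹) * h4

/-- inverse of `T` -/
def Ti : Matrix (Fin 2) (Fin 2) ℂ := !![1, 0; 0, -ω ^ 3]

lemma CTF_Ti {m : ℕ} (j : Fin m) : CTF j (fun _ => Ti) := by
  have := (((CTF_S j).mul (CTF_S j)).mul (CTF_S j)).mul (CTF_T j)
  convert this using 2
  rw [Smat_eq, Tmat, Ti]
  have h4 := ω_four
  simp only [Matrix.mul_fin_two]
  ext i j
  fin_cases i <;> fin_cases j <;> simp
  linear_combination -ω ^ 3 * h4

/-- `-iX` -/
def Vx : Matrix (Fin 2) (Fin 2) ℂ := !![0, -ω ^ 2; -ω ^ 2, 0]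

/-- `iX` -/
def Vi : Matrix (Fin 2) (Fin 2) ℂ := !![0, ω ^ 2; ω ^ 2, 0]

lemma CTF_Vi {m : ℕ} (j : Fin m) : CTF j (fun _ => Vi) := by
  have := ((CTF_ω j).mul (CTF_ω j)).mul (CTF_X j)
  convert this using 2
  rw [Vi, Xmat]
  simp only [Matrix.mul_fin_two]
  ext i j
  fin_cases i <;> fin_cases j <;> simp <;> ring

lemma CTF_Vx {m : ℕ} (j : Fin m) : CTF j (fun _ => Vx) := by
  have := (((CTF_ω j).mul (CTF_ω j)).mul ((CTF_ω j).mul (CTF_ω j))).mul (CTF_Vi j)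
  convert this using 2
  rw [Vi, Vx]
  have h4 := ω_four
  simp only [Matrix.mul_fin_two]
  ext i j
  fin_cases i <;> fin_cases j <;> simp <;> linear_combination -ω ^ 2 * h4

lemma X_X : Xmat * Xmat = 1 := by
  rw [Xmat, one_eq2]; simp [Matrix.mul_fin_two]

lemma CTF_cnot1 {m : ℕ} (a j : Fin m) (haj : a ≠ j) :
    CTF j (fun x => if x a = 1 then Xmat else 1) := by
  refine ⟨⟨⟨app2 CNOTmat a j, cnot_unitary a j haj⟩, ?_, fun v => ?_⟩, fun x b => ?_⟩
  · apply Subgroup.subset_closure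
    exact Or.inr (Or.inr (Or.inr (Or.inr ⟨a, j, haj, rfl⟩)))
  · rw [cnot_mulVec a j haj]
    funext x
    rcases (by omega : x a = 0 ∨ x a = 1) with h | h <;>
    rcases (by omega : x j = 0 ∨ x j = 1) with h' | h' <;>
    simp [Op, h, h', Xmat, Matrix.one_apply]
  · simp [haj]

lemma CTF_cnot {m : ℕ} (a j : Fin m) (haj : a ≠ j) (b : Fin 2) :
    CTF j (fun x => if x a = b then Xmat else 1) := by
  rcases (by omega : b = 0 ∨ b = 1) with rfl | rfl
  · have := (CTF_X j).mul (CTF_cnot1 a j haj)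
    convert this using 2 with x
    rcases (by omega : x a = 0 ∨ x a = 1) with h | h <;> simp [h, X_X]
  · exact CTF_cnot1 a j haj

lemma comm_eq : Xmat * Ti * Vx * Tmat * Xmat * Ti * Vi * Tmat = !![-ω ^ 2, 0; 0, ω ^ 2] := by
  rw [Xmat, Ti, Vx, Vi, Tmat]
  have h4 := ω_four
  simp only [Matrix.mul_fin_two]
  ext i j
  fin_cases i <;> fin_cases j <;> simp
  · linear_combination (ω ^ 6 - ω ^ 2) * h4
  · linear_combination (-ω ^ 2) * h4

lemma Ti_T : Ti * Tmat = 1 := by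
  rw [Ti, Tmat, one_eq2]
  have h4 := ω_four
  simp only [Matrix.mul_fin_two]
  ext i j
  fin_cases i <;> fin_cases j <;> simp
  linear_combination -h4

lemma T_Ti : Tmat * Ti = 1 := by
  rw [Ti, Tmat, one_eq2]
  have h4 := ω_four
  simp only [Matrix.mul_fin_two]
  ext i j
  fin_cases i <;> fin_cases j <;> simp
  linear_combination -h4

lemma Vx_Vi : Vx * Vi = 1 := by
  rw [Vx, Vi, one_eq2]
  have h4 := ω_four
  simp only [Matrix.mul_fin_two]
  ext i j
  fin_cases i <;> fin_cases j <;> simp <;> linear_combination -h4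

lemma Vx_cube : Vx * Vx * Vx = Vi := by
  rw [Vx, Vi]
  have h4 := ω_four
  simp only [Matrix.mul_fin_two]
  ext i j
  fin_cases i <;> fin_cases j <;> simp <;> linear_combination -ω ^ 2 * h4

lemma H_H : Hmat * Hmat = 1 := by
  rw [Hmat_eq, one_eq2]
  have h := s2inv_sq
  simp only [Matrix.mul_fin_two]
  ext i j
  fin_cases i <;> fin_cases j <;> simp [h] <;> norm_num

lemma H_Z_H : Hmat * !![-ω ^ 2, 0; 0, ω ^ 2] * Hmat = Vx := by
  rw [Hmat_eq, Vx]
  have h := s2inv_sq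
  simp only [Matrix.mul_fin_two]
  ext i j
  fin_cases i <;> fin_cases j <;> simp
  · linear_combination -2 * ω ^ 2 * h
  · linear_combination -2 * ω ^ 2 * h

lemma CTF_cube {m : ℕ} {j : Fin m} {c : (Fin m → Fin 2) → Prop} [DecidablePred c]
    (h : CTF j (fun x => if c x then Vx else 1)) : CTF j (fun x => if c x then Vi else 1) := by
  have := (h.mul h).mul h
  convert this using 2 with x
  by_cases hc : c x <;> simp [hc, Vx_cube]

/-- Multiply controlled `-iX` gates need no ancilla. -/
lemma CTF_multi {m : ℕ} (j : Fin m) (p : Fin m → Fin 2) (A : Finset (Fin m)) (hj : j ∉ A) :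
    CTF j (fun x => if ∀ i ∈ A, x i = p i then Vx else 1) := by
  induction A using Finset.induction_on with
  | empty => simpa using CTF_Vx j
  | insert a A ha ih =>
    have hjA : j ∉ A := fun h => hj (Finset.mem_insert_of_mem h)
    have haj : a ≠ j := by rintro rfl; exact hj (Finset.mem_insert_self _ _)
    have h1 := CTF_cnot a j haj (p a)
    have h2 := ih hjA
    have h3 := CTF_cube h2
    have h4 := ((((((h1.mul (CTF_Ti j)).mul h2).mul (CTF_T j)).mul h1).mul (CTF_Ti j)).mul h3).mul
      (CTF_T j)
    have h5 := ((CTF_H j).mul h4).mul (CTF_H j)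
    convert h5 using 2 with x
    have hiff : (∀ i ∈ insert a A, x i = p i) ↔ (x a = p a ∧ ∀ i ∈ A, x i = p i) := by simp
    by_cases c1 : x a = p a
    · by_cases c2 : ∀ i ∈ A, x i = p i
      · rw [if_pos (hiff.2 ⟨c1, c2⟩)]
        simp only [if_pos c1, if_pos c2, comm_eq, H_Z_H]
      · rw [if_neg (fun h => c2 (hiff.1 h).2)]
        simp only [if_pos c1, if_neg c2, mul_one]
        rw [mul_assoc Xmat, Ti_T, mul_one, X_X, one_mul, Ti_T, mul_one, H_H]
    · rw [if_neg (fun h => c1 (hiff.1 h).1)]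
      by_cases c2 : ∀ i ∈ A, x i = p i
      · simp only [if_neg c1, if_pos c2, mul_one, one_mul]
        rw [mul_assoc (Ti * Vx), T_Ti, mul_one, mul_assoc Ti, Vx_Vi, mul_one, Ti_T, mul_one, H_H]
      · simp only [if_neg c1, if_neg c2, mul_one, one_mul]
        rw [Ti_T, one_mul, Ti_T, mul_one, H_H]

/-- `-iH` -/
def Vh : Matrix (Fin 2) (Fin 2) ℂ := !![-ω ^ 2 * s2⁻¹, -ω ^ 2 * s2⁻¹; -ω ^ 2 * s2⁻¹, ω ^ 2 * s2⁻¹]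

lemma Vh_eq : Smat * Hmat * Tmat * Vx * Ti * Hmat * (Smat * Smat * Smat) = Vh := by
  rw [Smat_eq, Hmat_eq, Tmat, Vx, Ti, Vh]
  have h := s2inv_sq
  have h4 := ω_four
  have hs : s2⁻¹ = (ω - ω ^ 3) / 2 := by
    rw [← s2_eq, eq_div_iff (by norm_num), ← s2_sq, ← mul_assoc, inv_mul_cancel₀ s2_ne, one_mul]
  simp only [Matrix.mul_fin_two, hs]
  ext i j
  fin_cases i <;> fin_cases j <;> simp
  · grind
  · grind
  · grind
  · grind

lemma one_conj : Smat * Hmat * Tmat * 1 * Ti * Hmat * (Smat * Smat * Smat) = 1 := by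
  rw [mul_one, mul_assoc (Smat * Hmat), T_Ti, mul_one, mul_assoc Smat, H_H, mul_one, Smat_eq,
    one_eq2]
  simp only [Matrix.mul_fin_two]
  have h8 := ω_eight
  ext i j
  fin_cases i <;> fin_cases j <;> simp
  linear_combination h8

lemma CTF_multiH {m : ℕ} (j : Fin m) (p : Fin m → Fin 2) (A : Finset (Fin m)) (hj : j ∉ A) :
    CTF j (fun x => if ∀ i ∈ A, x i = p i then Vh else 1) := by
  have := ((((((CTF_S j).mul (CTF_H j)).mul (CTF_T j)).mul (CTF_multi j p A hj)).mul
    (CTF_Ti j)).mul (CTF_H j)).mul (((CTF_S j).mul (CTF_S j)).mul (CTF_S j))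
  convert this using 2 with x
  by_cases c : ∀ i ∈ A, x i = p i
  · simp only [if_pos c, Vh_eq]
  · simp only [if_neg c, one_conj]

lemma CTF_multiT {m : ℕ} (j : Fin m) (p : Fin m → Fin 2) (A : Finset (Fin m)) (hj : j ∉ A) :
    CTF j (fun x => if ∀ i ∈ A, x i = p i then !![ω, 0; 0, 1] else Tmat) := by
  have h := CTF_multi j p A hj
  have := (h.mul (CTF_T j)).mul (CTF_cube h)
  convert this using 2 with x
  by_cases c : ∀ i ∈ A, x i = p i
  · simp only [if_pos c]
    have h4 := ω_four
    rw [Vx, Tmat, Vi]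
    simp only [Matrix.mul_fin_two]
    ext i j
    fin_cases i <;> fin_cases j <;> simp
    · linear_combination ω * h4
    · linear_combination h4
  · simp only [if_neg c, one_mul, mul_one]

/-! ### Operators realised with one ancilla -/

/-- `f` is realised by a Clifford+T circuit with one ancilla. -/
def Good {n : ℕ} (f : ((Fin n → Fin 2) → ℂ) → ((Fin n → Fin 2) → ℂ)) : Prop :=
  ∃ U' ∈ CliffordT (n + 1), ∀ v,
    (U' : Matrix (Fin (n + 1) → Fin 2) (Fin (n + 1) → Fin 2) ℂ) *ᵥ (tensorVec v (e0 1))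
      = tensorVec (f v) (e0 1)

lemma Good.comp {n : ℕ} {f g : ((Fin n → Fin 2) → ℂ) → ((Fin n → Fin 2) → ℂ)} (hf : Good f)
    (hg : Good g) : Good (fun v => f (g v)) := by
  obtain ⟨U, hU, hUf⟩ := hf
  obtain ⟨V, hV, hVg⟩ := hg
  refine ⟨U * V, mul_mem hU hV, fun v => ?_⟩
  rw [← hUf, ← hVg, Matrix.mulVec_mulVec]
  rfl

lemma Good.id {n : ℕ} : Good (fun v : (Fin n → Fin 2) → ℂ => v) :=
  ⟨1, one_mem _, fun v => by simp⟩

lemma good_op {n : ℕ} (j : Fin n) (F : (Fin (n + 1) → Fin 2) → Matrix (Fin 2) (Fin 2) ℂ)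
    (Fn : (Fin n → Fin 2) → Matrix (Fin 2) (Fin 2) ℂ)
    (h : CTF (Fin.castAdd 1 j) F) (hF : ∀ x, F x = Fn (fun i => x (Fin.castAdd 1 i))) :
    Good (Op j Fn) := by
  obtain ⟨U, hU, hUF⟩ := h.1
  refine ⟨U, hU, fun v => ?_⟩
  rw [hUF]
  funext x
  have h1 : ∀ b, (fun i => Function.update x (Fin.castAdd 1 j) b (Fin.castAdd 1 i))
      = Function.update (fun i => x (Fin.castAdd 1 i)) j b := by
    intro b
    funext i
    by_cases hi : i = j
    · subst hi; simp
    · have : Fin.castAdd 1 i ≠ Fin.castAdd 1 j := fun h => hi (Fin.castAdd_injective n 1 h)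
      simp [hi]
  have h2 : ∀ b, (fun i : Fin 1 => Function.update x (Fin.castAdd 1 j) b (Fin.natAdd n i))
      = fun i => x (Fin.natAdd n i) := by
    intro b
    funext i
    apply Function.update_of_ne
    intro h
    have := congrArg Fin.val h
    simp at this
    omega
  simp only [Op, tensorVec, hF, h1, h2]
  ring

/-- two-level operator -/
def tl {n : ℕ} (M : Matrix (Fin 2) (Fin 2) ℂ) (p q : Fin n → Fin 2) (v : (Fin n → Fin 2) → ℂ) :
    (Fin n → Fin 2) → ℂ := fun x =>
  if x = p then M 0 0 * v p + M 0 1 * v q else if x = q then M 1 0 * v p + M 1 1 * v q else v x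

lemma upd_ne {n : ℕ} (p : Fin n → Fin 2) (j : Fin n) :
    Function.update p j 0 ≠ Function.update p j 1 := by
  intro h
  have := congrFun h j
  simp at this

lemma op_tl {n : ℕ} (M : Matrix (Fin 2) (Fin 2) ℂ) (p : Fin n → Fin 2) (j : Fin n) :
    Op j (fun x => if ∀ i, i ≠ j → x i = p i then M else 1)
      = tl M (Function.update p j 0) (Function.update p j 1) := by
  funext v x
  have hne := upd_ne p j
  by_cases h : ∀ i, i ≠ j → x i = p i
  · have hx : ∀ b, Function.update x j b = Function.update p j b := by
      intro b
      funext i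
      by_cases hi : i = j
      · subst hi; simp
      · simp [hi, h i hi]
    have hxx := Function.update_eq_self j x
    simp only [Op, if_pos h, hx, tl]
    rcases (by omega : x j = 0 ∨ x j = 1) with h' | h'
    · rw [h', hx] at hxx
      rw [← hxx, if_pos rfl]
      simp
    · rw [h', hx] at hxx
      rw [← hxx, if_neg hne.symm, if_pos rfl]
      simp
  · have hb : ∀ b, x ≠ Function.update p j b := by
      rintro b rfl
      apply h
      intro i hi
      simp [hi]
    have h1 := congrFun (Op_one j v) x
    simp only [Op] at h1
    simp only [Op, if_neg h, tl, if_neg (hb _)]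
    exact h1

lemma good_ctrl {n : ℕ} (M : Matrix (Fin 2) (Fin 2) ℂ) (p : Fin n → Fin 2) (j : Fin n)
    (hM : ∀ {m : ℕ} (j : Fin m) (p : Fin m → Fin 2) (A : Finset (Fin m)) (_ : j ∉ A),
      CTF j (fun x => if ∀ i ∈ A, x i = p i then M else 1)) :
    Good (tl M (Function.update p j 0) (Function.update p j 1)) := by
  rw [← op_tl]
  refine good_op j _ _ (hM (Fin.castAdd 1 j) (Fin.append p (fun _ => 0))
    ((Finset.univ.erase j).image (Fin.castAdd 1)) ?_) ?_
  · intro h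
    obtain ⟨i, hi, hi'⟩ := Finset.mem_image.1 h
    exact (Finset.ne_of_mem_erase hi) (Fin.castAdd_injective n 1 hi')
  · intro x
    have : (∀ i ∈ (Finset.univ.erase j).image (Fin.castAdd 1),
        x i = Fin.append p (fun _ : Fin 1 => 0) i) ↔ ∀ i, i ≠ j → x (Fin.castAdd 1 i) = p i := by
      constructor
      · intro h i hi
        rw [h _ (Finset.mem_image_of_mem _ (by simp [hi])), Fin.append_left]
      · intro h i hi
        obtain ⟨k, hk, rfl⟩ := Finset.mem_image.1 hi
        rw [h k (Finset.ne_of_mem_erase hk), Fin.append_left]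
    simp only [this]

lemma good_ph {n : ℕ} (p : Fin n → Fin 2) : Good (ph p) := by
  have h := CTF_multiT (Fin.natAdd n (0 : Fin 1)) (Fin.append p (fun _ => 0))
    (Finset.univ.image (Fin.castAdd 1)) (by
      intro h
      obtain ⟨i, _, hi'⟩ := Finset.mem_image.1 h
      have := congrArg Fin.val hi'
      simp at this
      omega)
  obtain ⟨U, hU, hUF⟩ := h.1
  refine ⟨U, hU, fun v => ?_⟩
  rw [hUF]
  funext x
  have hc : (∀ i ∈ Finset.univ.image (Fin.castAdd 1),
      x i = Fin.append p (fun _ : Fin 1 => 0) i) ↔ (fun i => x (Fin.castAdd 1 i)) = p := by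
    constructor
    · intro h
      funext i
      rw [h _ (Finset.mem_image_of_mem _ (by simp)), Fin.append_left]
    · intro h i hi
      obtain ⟨k, hk, rfl⟩ := Finset.mem_image.1 hi
      rw [← h, Fin.append_left]
  have h1 : ∀ b, (fun i => Function.update x (Fin.natAdd n (0 : Fin 1)) b (Fin.castAdd 1 i))
      = fun i => x (Fin.castAdd 1 i) := by
    intro b
    funext i
    apply Function.update_of_ne
    intro h
    have := congrArg Fin.val h
    simp at this
    omega
  have h2 : ∀ b, (fun i : Fin 1 => Function.update x (Fin.natAdd n (0 : Fin 1)) b (Fin.natAdd n i))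
      = fun _ => b := by
    intro b
    funext i
    rw [Subsingleton.elim i 0, Function.update_self]
  have h3 : (fun i : Fin 1 => x (Fin.natAdd n i)) = fun _ => x (Fin.natAdd n 0) := by
    funext i
    rw [Subsingleton.elim i 0]
  have h4 : ∀ b c : Fin 2, ((fun _ : Fin 1 => b) = fun _ => c) ↔ b = c :=
    fun b c => ⟨fun h => congrFun h 0, fun h => by rw [h]⟩
  simp only [Op, tensorVec, hc, h1, h2, h3, e0, h4, ph]
  by_cases hp : (fun i => x (Fin.castAdd 1 i)) = p
  · rcases (by omega : x (Fin.natAdd n 0) = 0 ∨ x (Fin.natAdd n 0) = 1) with h | h <;>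
      simp [h, hp]
  · rcases (by omega : x (Fin.natAdd n 0) = 0 ∨ x (Fin.natAdd n 0) = 1) with h | h <;>
      simp [h, hp, Tmat]

lemma good_i {n : ℕ} (M : Matrix (Fin 2) (Fin 2) ℂ) (p q : Fin n → Fin 2) (hpq : p ≠ q)
    (h : Good (tl M p q)) : Good (tl (ω ^ 2 • M) p q) := by
  have := (good_ph p).comp ((good_ph p).comp ((good_ph q).comp ((good_ph q).comp h)))
  convert this using 1
  funext v x
  by_cases h1 : x = p
  · subst h1; simp [ph, tl, hpq]; ring
  · by_cases h2 : x = q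
    · subst h2; simp [ph, tl, h1]; ring
    · simp [ph, tl, h1, h2]

lemma good_swap_adj {n : ℕ} (p : Fin n → Fin 2) (j : Fin n) :
    Good (sw (Function.update p j 0) (Function.update p j 1)) := by
  have h := good_i _ _ _ (upd_ne p j) (good_ctrl Vx p j CTF_multi)
  have hne := upd_ne p j
  convert h using 1
  have h4 := ω_four
  have e : ω ^ 2 * ω ^ 2 = -1 := by rw [← h4]; ring
  funext v x
  by_cases h1 : x = Function.update p j 0
  · subst h1; simp [sw, tl, Vx, e]
  · by_cases h2 : x = Function.update p j 1
    · subst h2; simp [sw, tl, Vx, hne.symm, e]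
    · simp [sw, tl, h1, h2, Equiv.swap_apply_of_ne_of_ne h1 h2]

lemma good_tlH_adj {n : ℕ} (p : Fin n → Fin 2) (j : Fin n) :
    Good (tlH (Function.update p j 0) (Function.update p j 1)) := by
  have h := good_i _ _ _ (upd_ne p j) (good_ctrl Vh p j CTF_multiH)
  have hne := upd_ne p j
  convert h using 1
  have h4 := ω_four
  have e : ω ^ 2 * ω ^ 2 = -1 := by rw [← h4]; ring
  funext v x
  by_cases h1 : x = Function.update p j 0
  · subst h1; simp [tlH, tl, Vh]
    linear_combination (v (Function.update p j 0) + v (Function.update p j 1)) * s2⁻¹ * e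
  · by_cases h2 : x = Function.update p j 1
    · subst h2; simp [tlH, tl, Vh, hne.symm]
      linear_combination (v (Function.update p j 0) - v (Function.update p j 1)) * s2⁻¹ * e
    · simp [tlH, tl, h1, h2]

lemma sw_comm {ι : Type} [DecidableEq ι] (p q : ι) : sw p q = sw q p := by
  funext v x
  simp only [sw, Equiv.swap_comm]

lemma good_sw_self {n : ℕ} (p : Fin n → Fin 2) : Good (sw p p) := by
  convert Good.id (n := n) using 1
  funext v x
  simp [sw]

lemma good_sw_trans {n : ℕ} {p q r : Fin n → Fin 2} (h1 : Good (sw p q)) (h2 : Good (sw q r)) :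
    Good (sw p r) := by
  by_cases hpr : p = r
  · subst hpr; exact good_sw_self p
  by_cases hpq : p = q
  · subst hpq; exact h2
  by_cases hqr : q = r
  · subst hqr; exact h1
  have := h1.comp (h2.comp h1)
  convert this using 1
  funext v x
  simp only [sw]
  congr 1
  by_cases x1 : x = p
  · subst x1
    simp [Equiv.swap_apply_of_ne_of_ne, Ne.symm hqr, Ne.symm hpr]
  · by_cases x2 : x = q
    · subst x2
      simp [Equiv.swap_apply_of_ne_of_ne, x1, hqr, hpr, hpq]
    · by_cases x3 : x = r
      · subst x3
        simp [Equiv.swap_apply_of_ne_of_ne, x1, x2]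
      · simp [Equiv.swap_apply_of_ne_of_ne, x1, x2, x3]

lemma good_sw_update {n : ℕ} (p : Fin n → Fin 2) (j : Fin n) (b : Fin 2) :
    Good (sw p (Function.update p j b)) := by
  have hp := Function.update_eq_self j p
  have h := good_swap_adj p j
  rcases (by omega : p j = 0 ∨ p j = 1) with h1 | h1 <;>
  rcases (by omega : b = 0 ∨ b = 1) with rfl | rfl <;> rw [h1] at hp
  · rw [hp]; exact good_sw_self p
  · rw [hp] at h; exact h
  · rw [hp, sw_comm] at h; exact h
  · rw [hp]; exact good_sw_self p

lemma good_sw {n : ℕ} (p q : Fin n → Fin 2) : Good (sw p q) := by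
  have key : ∀ A : Finset (Fin n), Good (sw p (fun i => if i ∈ A then q i else p i)) := by
    intro A
    induction A using Finset.induction_on with
    | empty => simpa using good_sw_self p
    | insert a A ha ih =>
      have := good_sw_trans ih (good_sw_update _ a (q a))
      convert this using 2
      funext i
      by_cases hi : i = a
      · subst hi; simp
      · simp [hi]
  simpa using key Finset.univ

lemma good_tlH_right {n : ℕ} {p q : Fin n → Fin 2} (hpq : p ≠ q) (r : Fin n → Fin 2) (hpr : p ≠ r)
    (h : Good (tlH p q)) : Good (tlH p r) := by
  have := (good_sw q r).comp (h.comp (good_sw q r))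
  convert this using 1
  funext v x
  by_cases x1 : x = p
  · subst x1; simp [sw, tlH, Equiv.swap_apply_of_ne_of_ne hpq hpr]
  · by_cases x2 : x = r
    · subst x2; simp [sw, tlH, Equiv.swap_apply_of_ne_of_ne hpq hpr, x1, hpq.symm]
    · have h1 : Equiv.swap q r x ≠ q := by
        intro h
        apply x2
        have := congrArg (Equiv.swap q r) h
        simpa using this
      have h2 : Equiv.swap q r x ≠ p := by
        intro h
        apply x1
        have := congrArg (Equiv.swap q r) h
        simpa [Equiv.swap_apply_of_ne_of_ne hpq hpr] using this
      simp [sw, tlH, x1, x2, h1, h2]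

lemma good_tlH_symm {n : ℕ} {p q : Fin n → Fin 2} (hpq : p ≠ q)
    (h : Good (tlH p q)) : Good (tlH q p) := by
  have := (good_sw p q).comp (h.comp (good_sw p q))
  convert this using 1
  funext v x
  by_cases x1 : x = p
  · subst x1; simp [sw, tlH, hpq, hpq.symm]
  · by_cases x2 : x = q
    · subst x2; simp [sw, tlH]
    · simp [sw, tlH, x1, x2, Equiv.swap_apply_of_ne_of_ne x1 x2]

lemma good_tlH {n : ℕ} (p q : Fin n → Fin 2) (hpq : p ≠ q) : Good (tlH p q) := by
  obtain ⟨j, _⟩ := Function.ne_iff.1 hpq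
  have hp := Function.update_eq_self j p
  have hne := upd_ne p j
  have h := good_tlH_adj p j
  rcases (by omega : p j = 0 ∨ p j = 1) with h1 | h1 <;> rw [h1] at hp
  · rw [hp] at h hne
    exact good_tlH_right hne q hpq h
  · rw [hp] at h hne
    exact good_tlH_right hne.symm q hpq (good_tlH_symm hne h)

lemma good_circ {n : ℕ} {f : ((Fin n → Fin 2) → ℂ) → ((Fin n → Fin 2) → ℂ)}
    (hf : Circ (∅ : Finset (Fin n → Fin 2)) f) : Good f := by
  induction hf with
  | nil => exact Good.id
  | H p q f hp hq hpq hf ih => exact (good_tlH p q hpq).comp ih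
  | T p f hp hf ih => exact (good_ph p).comp ih
  | X p q f hp hq hf ih => exact (good_sw p q).comp ih

end CTSynth

/-- Every unitary `2^n × 2^n` matrix with entries in `𝔻[ω] = ℤ[1/√2, i]` is implemented
by a Clifford+T operator on `n+1` qubits, with a single ancilla qubit initialized and
finalized in state `|0⟩`. -/
theorem stmt1 (n : ℕ) (U : Matrix (Fin n → Fin 2) (Fin n → Fin 2) ℂ)
    (hU : U ∈ Matrix.unitaryGroup (Fin n → Fin 2) ℂ)
    (hent : ∀ i j, inDω (U i j)) :
    ∃ U' ∈ CliffordT (n + 1), ∀ v : (Fin n → Fin 2) → ℂ,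
      Matrix.mulVec (U' : Matrix (Fin (n + 1) → Fin 2) (Fin (n + 1) → Fin 2) ℂ)
          (tensorVec v (e0 1))
        = tensorVec (U.mulVec v) (e0 1) := by
  obtain ⟨f, hf, hfU⟩ := CTSynth.decompose U hU hent
  obtain ⟨V, hV, hVf⟩ := CTSynth.good_circ hf
  refine ⟨V⁻¹, inv_mem hV, fun v => ?_⟩
  have h := hVf (U.mulVec v)
  rw [hfU] at h
  rw [← h, Matrix.mulVec_mulVec, ← Submonoid.coe_mul, inv_mul_cancel]
  simp
end
end

section
/- Let n ∈ ℕ and let U be a unitary 2^n × 2^n complex matrix all of whose entries belong to 𝔻[ω] = ℤ[1/√2, i], and suppose det U = 1. Then U is an element of the Clifford+T group on n qubits (i.e., U is exactly representable by a Clifford+T circuit on n qubits with no ancillas). -/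
noncomputable section

/-! ### Arithmetic in `ℤ[ω]` -/

lemma sq2_mul : (Real.sqrt 2 : ℂ) * (Real.sqrt 2 : ℂ) = 2 := by
  rw [← Complex.ofReal_mul, Real.mul_self_sqrt (by norm_num)]; norm_num

lemma sq2_ne : (Real.sqrt 2 : ℂ) ≠ 0 := by
  intro h; have := sq2_mul; rw [h] at this; norm_num at this

lemma om_mul_sq2 : ω * (Real.sqrt 2 : ℂ) = 1 + Complex.I := by
  unfold ω; field_simp [sq2_ne]

lemma om_sq : ω ^ 2 = Complex.I := by
  have h : (ω * (Real.sqrt 2 : ℂ)) ^ 2 = 2 * Complex.I := by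
    rw [om_mul_sq2]; linear_combination Complex.I_sq
  have h2 : ω ^ 2 * 2 = 2 * Complex.I := by
    rw [← h]; linear_combination (-ω ^ 2) * sq2_mul
  linear_combination h2 / 2

lemma om4 : ω ^ 4 = -1 := by
  linear_combination (ω ^ 2 + Complex.I) * om_sq + Complex.I_sq

lemma om8 : ω ^ 8 = 1 := by
  linear_combination (ω ^ 4 - 1) * om4

lemma om_ne : ω ≠ 0 := by
  intro h; have := om4; rw [h] at this; norm_num at this

lemma sq2_eq : (Real.sqrt 2 : ℂ) = ω - ω ^ 3 := by
  have h : ω * (Real.sqrt 2 : ℂ) = ω * (ω - ω ^ 3) := by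
    rw [om_mul_sq2, ← om_sq]; linear_combination om4
  exact mul_left_cancel₀ om_ne h

lemma star_om : star ω = -ω ^ 3 := by
  have h : star ω * (Real.sqrt 2 : ℂ) = 1 - Complex.I := by
    have := congrArg star om_mul_sq2
    simpa [mul_comm, sub_eq_add_neg] using this
  have h2 : (-ω ^ 3) * (Real.sqrt 2 : ℂ) = 1 - Complex.I := by
    rw [sq2_eq, ← om_sq]; linear_combination (ω ^ 2 - 1) * om4
  exact mul_right_cancel₀ sq2_ne (h.trans h2.symm)

/-- The ring `ℤ[ω]` as a subring of `ℂ`. -/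
def Zom : Subring ℂ where
  carrier := {t | inZω t}
  mul_mem' := by
    rintro x y ⟨a, b, c, d, rfl⟩ ⟨a', b', c', d', rfl⟩
    refine ⟨a * d' + b * c' + c * b' + d * a', b * d' + c * c' + d * b' - a * a',
      c * d' + d * c' - a * b' - b * a', d * d' - a * c' - b * b' - c * a', ?_⟩
    push_cast
    linear_combination (a * a' * ω ^ 2 + (a * b' + b * a') * ω + (a * c' + b * b' + c * a')) * om4
  one_mem' := ⟨0, 0, 0, 1, by simp⟩
  add_mem' := by
    rintro x y ⟨a, b, c, d, rfl⟩ ⟨a', b', c', d', rfl⟩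
    exact ⟨a + a', b + b', c + c', d + d', by push_cast; ring1⟩
  zero_mem' := ⟨0, 0, 0, 0, by simp⟩
  neg_mem' := by
    rintro x ⟨a, b, c, d, rfl⟩
    exact ⟨-a, -b, -c, -d, by push_cast; ring1⟩

lemma om_mem : ω ∈ Zom := ⟨0, 0, 1, 0, by simp⟩

lemma sq2_mem : (Real.sqrt 2 : ℂ) ∈ Zom := by
  rw [sq2_eq]; exact sub_mem om_mem (pow_mem om_mem 3)

lemma I_mem : Complex.I ∈ Zom := by
  rw [← om_sq]; exact pow_mem om_mem 2

lemma star_mem_Zom {t : ℂ} (h : t ∈ Zom) : star t ∈ Zom := by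
  obtain ⟨a, b, c, d, rfl⟩ := h
  simp only [star_add, star_mul', star_pow, star_om, star_intCast]
  have hs : (-ω ^ 3) ∈ Zom := neg_mem (pow_mem om_mem 3)
  exact add_mem (add_mem (add_mem (mul_mem (intCast_mem _ _) (pow_mem hs _))
    (mul_mem (intCast_mem _ _) (pow_mem hs _))) (mul_mem (intCast_mem _ _) hs)) (intCast_mem _ _)

/-- The prime element `1 + ω` above `2`. -/
def del : ℂ := 1 + ω

lemma del_mem : del ∈ Zom := add_mem (one_mem _) om_mem

/-- `δ² = √2 · ω (1 + √2)`. -/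
lemma del_sq : del ^ 2 = (Real.sqrt 2 : ℂ) * (ω * (1 + (Real.sqrt 2 : ℂ))) := by
  unfold del; rw [sq2_eq]; linear_combination (1 + 2 * ω - ω ^ 3) * om4

lemma del_ne : del ≠ 0 := by
  intro h
  have h2 : ω = -1 := by unfold del at h; linear_combination h
  have := om4; rw [h2] at this; norm_num at this

/-- `√2 / δ ∈ ℤ[ω]`. -/
lemma sq2_div_del : (Real.sqrt 2 : ℂ) / del ∈ Zom := by
  have : (Real.sqrt 2 : ℂ) / del = ω - ω ^ 2 := by
    rw [div_eq_iff del_ne, sq2_eq]; unfold del; ring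
  rw [this]; exact sub_mem om_mem (pow_mem om_mem 2)

lemma two_div_del : 2 / del ∈ Zom := by
  rw [← sq2_mul, mul_div_assoc]; exact mul_mem sq2_mem sq2_div_del

lemma two_div_sd : 2 / ((Real.sqrt 2 : ℂ) * del) ∈ Zom := by
  have : 2 / ((Real.sqrt 2 : ℂ) * del) = (Real.sqrt 2 : ℂ) / del := by
    rw [← sq2_mul, mul_div_mul_left _ _ sq2_ne]
  rw [this]; exact sq2_div_del

lemma integral_Zom {t : ℂ} (h : t ∈ Zom) : IsIntegral ℤ t := by
  have ho : IsIntegral ℤ ω := by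
    refine IsIntegral.of_pow (n := 8) (by norm_num) ?_
    rw [om8]; exact isIntegral_one
  have hi : ∀ a : ℤ, IsIntegral ℤ (a : ℂ) := fun a => isIntegral_algebraMap (R := ℤ) (x := a)
  obtain ⟨a, b, c, d, rfl⟩ := h
  exact ((((hi a).mul (ho.pow 3)).add ((hi b).mul (ho.pow 2))).add ((hi c).mul ho)).add (hi d)

lemma inv_del_notMem : 1 / del ∉ Zom := by
  intro h
  have h2 : (1 / 2 : ℂ) ∈ Zom := by
    have e : (1 / 2 : ℂ) = (1 / del) ^ 4 * (ω * (1 + (Real.sqrt 2 : ℂ))) ^ 2 := by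
      have h4 : del ^ 4 = 2 * (ω * (1 + (Real.sqrt 2 : ℂ))) ^ 2 := by
        rw [← sq2_mul]
        linear_combination (del ^ 2 + (Real.sqrt 2 : ℂ) * (ω * (1 + (Real.sqrt 2 : ℂ)))) * del_sq
      have := del_ne
      field_simp
      linear_combination h4
    rw [e]
    exact mul_mem (pow_mem h 4) (pow_mem (mul_mem om_mem (add_mem (one_mem _) sq2_mem)) 2)
  have h3 := integral_Zom h2
  have h4 : IsIntegral ℤ (1 / 2 : ℚ) := by
    have : (1 / 2 : ℂ) = algebraMap ℚ ℂ (1 / 2) := by simp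
    rw [this] at h3
    exact (isIntegral_algebraMap_iff (algebraMap ℚ ℂ).injective).1 h3
  obtain ⟨k, hk⟩ := IsIntegrallyClosed.isIntegral_iff.1 h4
  have h5 : (2 * k : ℚ) = 1 := by
    have : (k : ℚ) = 1 / 2 := by simpa using hk
    rw [this]; norm_num
  have h6 : 2 * k = 1 := by exact_mod_cast h5
  omega

/-- Every odd element is congruent to a power of `ω` modulo `√2 δ`. -/
lemma odd_cong {p : ℂ} (hp : p ∈ Zom) (ho : p / del ∉ Zom) :
    ∃ m : ℕ, (p - ω ^ m) / ((Real.sqrt 2 : ℂ) * del) ∈ Zom := by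
  obtain ⟨a, b, c, d, rfl⟩ := hp
  have hodd : ¬ Even (d - c + b - a) := by
    rintro ⟨e, he⟩
    apply ho
    have he' : (d : ℂ) - c + b - a = e + e := by exact_mod_cast he
    have : ((a : ℂ) * ω ^ 3 + b * ω ^ 2 + c * ω + d) / del
        = ((a * ω ^ 2 + ((b - a : ℤ) : ℂ) * ω + ((c - b + a : ℤ) : ℂ))) + e * (2 / del) := by
      have := del_ne
      field_simp
      push_cast
      unfold del
      linear_combination he'
    rw [this]
    exact add_mem (add_mem (add_mem (mul_mem (intCast_mem _ _) (pow_mem om_mem 2))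
      (mul_mem (intCast_mem _ _) om_mem)) (intCast_mem _ _))
      (mul_mem (intCast_mem _ _) two_div_del)
  have key : ∀ (m : ℕ) (r e : ℂ), r ∈ Zom → e ∈ Zom →
      (a : ℂ) * ω ^ 3 + b * ω ^ 2 + c * ω + d = ω ^ m + 2 * r + (1 + ω + ω ^ 2 + ω ^ 3) * e →
      ∃ m : ℕ, ((a : ℂ) * ω ^ 3 + b * ω ^ 2 + c * ω + d - ω ^ m) / ((Real.sqrt 2 : ℂ) * del)
        ∈ Zom := by
    intro m r e hr hE h
    refine ⟨m, ?_⟩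
    have h1 : (1 + ω + ω ^ 2 + ω ^ 3) = (Real.sqrt 2 : ℂ) * del * ω := by
      rw [sq2_eq]; unfold del; linear_combination (ω + 1) * om4
    have : ((a : ℂ) * ω ^ 3 + b * ω ^ 2 + c * ω + d - ω ^ m) / ((Real.sqrt 2 : ℂ) * del)
        = 2 / ((Real.sqrt 2 : ℂ) * del) * r + ω * e := by
      rw [h, h1]
      have := del_ne; have := sq2_ne
      field_simp; ring
    rw [this]
    exact add_mem (mul_mem two_div_sd hr) (mul_mem om_mem hE)
  have mk : ∀ a b c d : ℤ, (a : ℂ) * ω ^ 3 + b * ω ^ 2 + c * ω + d ∈ Zom :=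
    fun a b c d => ⟨a, b, c, d, rfl⟩
  rcases Int.even_or_odd' a with ⟨a', rfl | rfl⟩ <;> rcases Int.even_or_odd' b with ⟨b', rfl | rfl⟩ <;>
  rcases Int.even_or_odd' c with ⟨c', rfl | rfl⟩ <;> rcases Int.even_or_odd' d with ⟨d', rfl | rfl⟩
  all_goals first
    | (exfalso; apply hodd; rw [Int.even_iff]; omega)
    | (refine key 0 _ 0 (mk a' b' c' d') (zero_mem _) ?_; push_cast; ring1)
    | (refine key 1 _ 0 (mk a' b' c' d') (zero_mem _) ?_; push_cast; ring1)
    | (refine key 2 _ 0 (mk a' b' c' d') (zero_mem _) ?_; push_cast; ring1)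
    | (refine key 3 _ 0 (mk a' b' c' d') (zero_mem _) ?_; push_cast; ring1)
    | (refine key 0 _ 1 (mk a' b' c' (d' - 1)) (one_mem _) ?_; push_cast; ring1)
    | (refine key 1 _ 1 (mk a' b' (c' - 1) d') (one_mem _) ?_; push_cast; ring1)
    | (refine key 2 _ 1 (mk a' (b' - 1) c' d') (one_mem _) ?_; push_cast; ring1)
    | (refine key 3 _ 1 (mk (a' - 1) b' c' d') (one_mem _) ?_; push_cast; ring1)

/-- Two odd elements can be aligned by a power of `ω`. -/
lemma odd_pair {p q : ℂ} (hp : p ∈ Zom) (hq : q ∈ Zom) (ho : p / del ∉ Zom) (ho' : q / del ∉ Zom) :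
    ∃ m : ℕ, (p + ω ^ m * q) / ((Real.sqrt 2 : ℂ) * del) ∈ Zom := by
  obtain ⟨m, hm⟩ := odd_cong hp ho
  obtain ⟨k, hk⟩ := odd_cong hq ho'
  refine ⟨m + 7 * k, ?_⟩
  have e : ω ^ (m + 7 * k) * ω ^ k = ω ^ m := by
    rw [← pow_add, show m + 7 * k + k = m + 8 * k by ring, pow_add, pow_mul ω 8, om8]; simp
  have : (p + ω ^ (m + 7 * k) * q) / ((Real.sqrt 2 : ℂ) * del)
      = (p - ω ^ m) / ((Real.sqrt 2 : ℂ) * del)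
        + ω ^ (m + 7 * k) * ((q - ω ^ k) / ((Real.sqrt 2 : ℂ) * del))
        + 2 / ((Real.sqrt 2 : ℂ) * del) * ω ^ m := by
    have := del_ne; have := sq2_ne
    field_simp
    linear_combination e
  rw [this]
  exact add_mem (add_mem hm (mul_mem (pow_mem om_mem _) hk)) (mul_mem two_div_sd (pow_mem om_mem _))

/-- An odd element has `p * star p ≡ 1` modulo `δ`. -/
lemma odd_norm {p : ℂ} (hp : p ∈ Zom) (ho : p / del ∉ Zom) :
    (star p * p - 1) / del ∈ Zom := by
  obtain ⟨m, hm⟩ := odd_cong hp ho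
  have h1 : (p - ω ^ m) / del ∈ Zom := by
    have : (p - ω ^ m) / del = (Real.sqrt 2 : ℂ) * ((p - ω ^ m) / ((Real.sqrt 2 : ℂ) * del)) := by
      have := del_ne; have := sq2_ne
      field_simp
    rw [this]; exact mul_mem sq2_mem hm
  have hsd : star del = -ω ^ 3 * del := by
    unfold del; rw [star_add, star_one, star_om]; linear_combination om4
  have h2 : (star p - star (ω ^ m)) / del ∈ Zom := by
    have h := star_mem_Zom h1
    rw [star_div₀, hsd, star_sub] at h
    have : (star p - star (ω ^ m)) / del = -ω ^ 3 * ((star p - star (ω ^ m)) / (-ω ^ 3 * del)) := by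
      have := del_ne; have := om_ne
      field_simp
    rw [this]; exact mul_mem (neg_mem (pow_mem om_mem 3)) h
  have h3 : star (ω ^ m) * ω ^ m = 1 := by
    rw [star_pow, star_om, ← mul_pow, show -ω ^ 3 * ω = 1 by linear_combination -om4, one_pow]
  have : (star p * p - 1) / del = star p * ((p - ω ^ m) / del)
      + ω ^ m * ((star p - star (ω ^ m)) / del) := by
    have := del_ne
    field_simp
    linear_combination h3
  rw [this]
  exact add_mem (mul_mem (star_mem_Zom hp) h1) (mul_mem (pow_mem om_mem _) h2)

lemma int_unit {a b c d : ℤ} (h : a ^ 2 + b ^ 2 + c ^ 2 + d ^ 2 = 1) :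
    ∃ m : ℕ, (a : ℂ) * ω ^ 3 + b * ω ^ 2 + c * ω + d = ω ^ m := by
  have ha : -1 ≤ a ∧ a ≤ 1 := by constructor <;> nlinarith [sq_nonneg b, sq_nonneg c, sq_nonneg d]
  have hb : -1 ≤ b ∧ b ≤ 1 := by constructor <;> nlinarith [sq_nonneg a, sq_nonneg c, sq_nonneg d]
  have hc : -1 ≤ c ∧ c ≤ 1 := by constructor <;> nlinarith [sq_nonneg a, sq_nonneg b, sq_nonneg d]
  have hd : -1 ≤ d ∧ d ≤ 1 := by constructor <;> nlinarith [sq_nonneg a, sq_nonneg b, sq_nonneg c]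
  obtain ⟨ha1, ha2⟩ := ha
  obtain ⟨hb1, hb2⟩ := hb
  obtain ⟨hc1, hc2⟩ := hc
  obtain ⟨hd1, hd2⟩ := hd
  interval_cases a <;> interval_cases b <;> interval_cases c <;> interval_cases d <;>
    first
    | (exfalso; revert h; decide)
    | exact ⟨0, by push_cast; ring1⟩
    | exact ⟨1, by push_cast; ring1⟩
    | exact ⟨2, by push_cast; ring1⟩
    | exact ⟨3, by push_cast; ring1⟩
    | exact ⟨4, by push_cast; linear_combination -om4⟩
    | exact ⟨5, by push_cast; linear_combination -ω * om4⟩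
    | exact ⟨6, by push_cast; linear_combination -ω ^ 2 * om4⟩
    | exact ⟨7, by push_cast; linear_combination -ω ^ 3 * om4⟩

/-- Unit vectors over `ℤ[ω]` are trivial. -/
lemma unit_vec {ι : Type*} [Fintype ι] [DecidableEq ι] (v : ι → ℂ) (hv : ∀ i, v i ∈ Zom)
    (hn : ∑ i, star (v i) * v i = 1) : ∃ (b : ι) (m : ℕ), v = Pi.single b (ω ^ m) := by
  choose a b c d h using hv
  have hnorm : ∀ i, star (v i) * v i
      = (((a i ^ 2 + b i ^ 2 + c i ^ 2 + d i ^ 2 : ℤ) : ℝ)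
        + Real.sqrt 2 * ((a i * b i + b i * c i + c i * d i - a i * d i : ℤ) : ℝ) : ℝ) := by
    intro i
    rw [h i]
    simp only [star_add, star_mul', star_pow, star_om, star_intCast]
    push_cast
    rw [sq2_eq]
    ring_nf
    have h5 : ω ^ 5 = -ω := by linear_combination ω * om4
    have h6 : ω ^ 6 = -ω ^ 2 := by linear_combination ω ^ 2 * om4
    have h7 : ω ^ 7 = -ω ^ 3 := by linear_combination ω ^ 3 * om4
    have h9 : ω ^ 9 = ω := by linear_combination ω * om8
    have h10 : ω ^ 10 = ω ^ 2 := by linear_combination ω ^ 2 * om8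
    have h11 : ω ^ 11 = ω ^ 3 := by linear_combination ω ^ 3 * om8
    have h12 : ω ^ 12 = -1 := by linear_combination ω ^ 4 * om8 + om4
    simp only [h5, h6, h7, om8, h9, h10, h11, h12, om4]
    ring
  set N : ι → ℤ := fun i => a i ^ 2 + b i ^ 2 + c i ^ 2 + d i ^ 2 with hN
  set M : ι → ℤ := fun i => a i * b i + b i * c i + c i * d i - a i * d i with hM
  have hsum : ((∑ i, N i : ℤ) : ℝ) + Real.sqrt 2 * ((∑ i, M i : ℤ) : ℝ) = 1 := by
    have : (((∑ i, ((N i : ℝ) + Real.sqrt 2 * (M i : ℝ)) : ℝ)) : ℂ) = 1 := by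
      rw [← hn, Complex.ofReal_sum]
      exact Finset.sum_congr rfl fun i _ => (hnorm i).symm
    have h2 : (∑ i, ((N i : ℝ) + Real.sqrt 2 * (M i : ℝ)) : ℝ) = 1 := by exact_mod_cast this
    rw [← h2, Finset.sum_add_distrib (f := fun i => (N i : ℝ)), ← Finset.mul_sum]
    push_cast
    rfl
  have hM0 : (∑ i, M i) = 0 := by
    by_contra hne
    have hirr := irrational_sqrt_two.mul_intCast hne
    apply hirr.ne_int (1 - ∑ i, N i)
    push_cast at hsum ⊢
    linarith
  have hN1 : (∑ i, N i) = 1 := by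
    rw [hM0] at hsum
    simp only [Int.cast_zero, mul_zero, add_zero] at hsum
    exact_mod_cast hsum
  have hpos : ∀ i, 0 ≤ N i := fun i => by simp only [hN]; positivity
  obtain ⟨i, hi⟩ : ∃ i, N i ≠ 0 := by
    by_contra hcon
    push Not at hcon
    simp [hcon] at hN1
  have hrest := Finset.add_sum_erase Finset.univ N (Finset.mem_univ i)
  have hr0 : 0 ≤ ∑ j ∈ Finset.univ.erase i, N j := Finset.sum_nonneg fun j _ => hpos j
  have hi1 : N i = 1 := by have := hpos i; omega
  have hz : ∑ j ∈ Finset.univ.erase i, N j = 0 := by omega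
  rw [Finset.sum_eq_zero_iff_of_nonneg fun j _ => hpos j] at hz
  obtain ⟨m, hm⟩ := int_unit hi1
  refine ⟨i, m, ?_⟩
  funext j
  by_cases hj : j = i
  · subst hj; rw [Pi.single_eq_same, ← hm]; exact h j
  · rw [Pi.single_eq_of_ne hj, h j]
    have h0 : a j ^ 2 + b j ^ 2 + c j ^ 2 + d j ^ 2 = 0 := hz j (by simp [hj])
    have ha : a j = 0 := by nlinarith [sq_nonneg (a j), sq_nonneg (b j), sq_nonneg (c j), sq_nonneg (d j)]
    have hb : b j = 0 := by nlinarith [sq_nonneg (a j), sq_nonneg (b j), sq_nonneg (c j), sq_nonneg (d j)]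
    have hc : c j = 0 := by nlinarith [sq_nonneg (a j), sq_nonneg (b j), sq_nonneg (c j), sq_nonneg (d j)]
    have hd : d j = 0 := by nlinarith [sq_nonneg (a j), sq_nonneg (b j), sq_nonneg (c j), sq_nonneg (d j)]
    simp [ha, hb, hc, hd]

/-- The ring `𝔻[ω]`, described through denominators `δ^l`. -/
def Dom : Subring ℂ where
  carrier := {t | ∃ l : ℕ, del ^ l * t ∈ Zom}
  mul_mem' := by
    rintro x y ⟨l, hl⟩ ⟨k, hk⟩
    refine ⟨l + k, ?_⟩
    rw [show del ^ (l + k) * (x * y) = del ^ l * x * (del ^ k * y) by ring]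
    exact mul_mem hl hk
  one_mem' := ⟨0, by simp [one_mem]⟩
  add_mem' := by
    rintro x y ⟨l, hl⟩ ⟨k, hk⟩
    refine ⟨l + k, ?_⟩
    rw [show del ^ (l + k) * (x + y) = del ^ k * (del ^ l * x) + del ^ l * (del ^ k * y) by ring]
    exact add_mem (mul_mem (pow_mem del_mem _) hl) (mul_mem (pow_mem del_mem _) hk)
  zero_mem' := ⟨0, by simp [zero_mem]⟩
  neg_mem' := by
    rintro x ⟨l, hl⟩
    exact ⟨l, by rw [mul_neg]; exact neg_mem hl⟩

lemma Zom_le {t : ℂ} (h : t ∈ Zom) : t ∈ Dom := ⟨0, by simpa using h⟩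

lemma inv_sq2_Dom : ((Real.sqrt 2 : ℂ))⁻¹ ∈ Dom := by
  refine ⟨2, ?_⟩
  have : del ^ 2 * ((Real.sqrt 2 : ℂ))⁻¹ = ω * (1 + (Real.sqrt 2 : ℂ)) := by
    rw [del_sq]; have := sq2_ne; field_simp
  rw [this]; exact mul_mem om_mem (add_mem (one_mem _) sq2_mem)

lemma dyadic_Dom {q : ℚ} (h : IsDyadic q) : (q : ℂ) ∈ Dom := by
  obtain ⟨a, n, rfl⟩ := h
  have : (((a : ℚ) / 2 ^ n : ℚ) : ℂ) = a * (((Real.sqrt 2 : ℂ))⁻¹ * ((Real.sqrt 2 : ℂ))⁻¹) ^ n := by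
    rw [← mul_inv, sq2_mul]; push_cast; rw [inv_pow]; rfl
  rw [this]
  exact mul_mem (intCast_mem _ _) (pow_mem (mul_mem inv_sq2_Dom inv_sq2_Dom) _)

lemma inDω_Dom {t : ℂ} (h : inDω t) : t ∈ Dom := by
  obtain ⟨a, b, c, d, ha, hb, hc, hd, rfl⟩ := h
  have ho := Zom_le om_mem
  exact add_mem (add_mem (add_mem (mul_mem (dyadic_Dom ha) (pow_mem ho _))
    (mul_mem (dyadic_Dom hb) (pow_mem ho _))) (mul_mem (dyadic_Dom hc) ho)) (dyadic_Dom hd)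

/-! ### Two-level operators and column reduction -/

section TwoLevel

set_option linter.unusedSimpArgs false
set_option linter.unusedSectionVars false
open scoped Matrix

variable {ι : Type*} [Fintype ι] [DecidableEq ι]

/-- The isometry `ℂ² → ℂ^ι` onto the coordinates `x, y`. -/
def Emat (x y : ι) : Matrix ι (Fin 2) ℂ := Matrix.of fun i k =>
  ![if i = x then 1 else 0, if i = y then 1 else 0] k

/-- The two-level operator acting as `A` on the coordinates `x, y`. -/
def tl (x y : ι) (A : Matrix (Fin 2) (Fin 2) ℂ) : Matrix ι ι ℂ :=
  1 + Emat x y * ((A - 1) * (Emat x y)ᵀ)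

lemma EtE {x y : ι} (h : x ≠ y) : (Emat x y)ᵀ * Emat x y = 1 := by
  ext i j
  fin_cases i <;> fin_cases j <;> simp [Matrix.mul_apply, Emat, h, h.symm]

lemma tl_one (x y : ι) : tl x y 1 = 1 := by simp [tl]

lemma tl_mul {x y : ι} (h : x ≠ y) (A B : Matrix (Fin 2) (Fin 2) ℂ) :
    tl x y A * tl x y B = tl x y (A * B) := by
  have e : (Emat x y)ᵀ * (Emat x y * ((B - 1) * (Emat x y)ᵀ)) = (B - 1) * (Emat x y)ᵀ := by
    rw [← Matrix.mul_assoc, EtE h, Matrix.one_mul]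
  unfold tl
  have e2 : Emat x y * ((A - 1) * (Emat x y)ᵀ) * (Emat x y * ((B - 1) * (Emat x y)ᵀ))
      = Emat x y * (((A - 1) * (B - 1)) * (Emat x y)ᵀ) := by
    rw [Matrix.mul_assoc (Emat x y), Matrix.mul_assoc (A - 1), e, Matrix.mul_assoc (A - 1)]
  have e3 : A * B - 1 = (A - 1) + (B - 1) + (A - 1) * (B - 1) := by noncomm_ring
  rw [Matrix.mul_add, Matrix.add_mul, Matrix.mul_one, Matrix.mul_one, Matrix.add_mul, Matrix.one_mul, e2, e3,
    Matrix.add_mul, Matrix.add_mul, Matrix.mul_add, Matrix.mul_add]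
  abel

lemma tl_star (x y : ι) (A : Matrix (Fin 2) (Fin 2) ℂ) :
    star (tl x y A) = tl x y (star A) := by
  have hE : (Emat x y)ᴴ = (Emat x y)ᵀ := by
    ext i j
    simp only [Emat, Matrix.conjTranspose_apply, Matrix.transpose_apply, Matrix.of_apply]
    first | (fin_cases j <;> simp [apply_ite]) | (fin_cases i <;> simp [apply_ite])
  have hE' : ((Emat x y)ᵀ)ᴴ = Emat x y := by
    ext i j
    simp only [Emat, Matrix.conjTranspose_apply, Matrix.transpose_apply, Matrix.of_apply]
    first | (fin_cases j <;> simp [apply_ite]) | (fin_cases i <;> simp [apply_ite])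
  simp only [tl, Matrix.star_eq_conjTranspose, Matrix.conjTranspose_add, Matrix.conjTranspose_mul,
    Matrix.conjTranspose_sub, Matrix.conjTranspose_one, hE, hE', Matrix.mul_assoc]

lemma tl_det {x y : ι} (h : x ≠ y) (A : Matrix (Fin 2) (Fin 2) ℂ) : (tl x y A).det = A.det := by
  unfold tl
  rw [Matrix.det_one_add_mul_comm, Matrix.mul_assoc, EtE h, Matrix.mul_one]
  congr 1; abel

lemma tl_mulVec {x y : ι} (h : x ≠ y) (A : Matrix (Fin 2) (Fin 2) ℂ) (v : ι → ℂ) (i : ι) :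
    (tl x y A *ᵥ v) i = if i = x then A 0 0 * v x + A 0 1 * v y
      else if i = y then A 1 0 * v x + A 1 1 * v y else v i := by
  have e : (Emat x y)ᵀ *ᵥ v = ![v x, v y] := by
    ext k; fin_cases k <;> simp [Matrix.mulVec, dotProduct, Emat]
  unfold tl
  rw [Matrix.add_mulVec, Matrix.one_mulVec, ← Matrix.mulVec_mulVec, ← Matrix.mulVec_mulVec, e]
  simp only [Pi.add_apply, Matrix.mulVec, dotProduct, Fin.sum_univ_two, Emat, Matrix.of_apply,
    Matrix.cons_val_zero, Matrix.cons_val_one, Matrix.sub_apply, Matrix.one_apply]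
  by_cases h1 : i = x
  · subst h1; simp [h]; ring
  · by_cases h2 : i = y
    · subst h2; simp [h1]; ring
    · simp [h1, h2]

lemma tl_unitary {x y : ι} (h : x ≠ y) {A : Matrix (Fin 2) (Fin 2) ℂ} (hA : star A * A = 1) :
    tl x y A ∈ Matrix.unitaryGroup ι ℂ := by
  rw [Matrix.mem_unitaryGroup_iff', tl_star, tl_mul h, hA, tl_one]

lemma mat_ext {M N : Matrix ι ι ℂ} (h : ∀ v i, (M *ᵥ v) i = (N *ᵥ v) i) : M = N := by
  ext i j
  have := h (Pi.single j 1) i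
  simpa [Matrix.mulVec_single_one] using this

/-- The gate `T^{-m} (iH) T^m`. -/
def Kg (m : ℕ) : Matrix (Fin 2) (Fin 2) ℂ :=
  (Complex.I * ((Real.sqrt 2 : ℂ))⁻¹) • !![1, ω ^ m; ω ^ (7 * m), -1]

lemma cc_sq : (Complex.I * ((Real.sqrt 2 : ℂ))⁻¹) * (Complex.I * ((Real.sqrt 2 : ℂ))⁻¹) = -1 / 2 := by
  have := sq2_ne
  field_simp
  linear_combination 2 * Complex.I_sq + sq2_mul

lemma om_pow8 (m : ℕ) : ω ^ m * ω ^ (7 * m) = 1 := by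
  rw [← pow_add, show m + 7 * m = 8 * m by ring, pow_mul, om8, one_pow]

lemma star_om_pow (m : ℕ) : star (ω ^ m) = ω ^ (7 * m) := by
  rw [star_pow, star_om, pow_mul]; congr 1; linear_combination -ω ^ 3 * om4

lemma star_om_pow7 (m : ℕ) : star (ω ^ (7 * m)) = ω ^ m := by
  rw [← star_om_pow, star_star]

lemma Kg_star (m : ℕ) : star (Kg m) = (-1 : ℂ) • Kg m := by
  ext i j
  fin_cases i <;> fin_cases j <;>
    simp [Kg, Matrix.star_apply, -star_pow, star_om_pow7, -RCLike.star_def] <;>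
    try exact (star_pow ω m).symm.trans (star_om_pow m)

lemma Kg_sq (m : ℕ) : Kg m * Kg m = (-1 : ℂ) • (1 : Matrix (Fin 2) (Fin 2) ℂ) := by
  have h8 := om_pow8 m
  rw [Kg, Matrix.smul_mul, Matrix.mul_smul, smul_smul, cc_sq]
  ext i j
  fin_cases i <;> fin_cases j <;> simp [Matrix.mul_apply, Fin.sum_univ_two]
  · linear_combination -h8 / 2
  · linear_combination -h8 / 2

lemma Kg_unitary (m : ℕ) : star (Kg m) * Kg m = 1 := by
  rw [Kg_star, Matrix.smul_mul, Kg_sq, smul_smul]; simp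

lemma Kg_det (m : ℕ) : (Kg m).det = 1 := by
  have h8 := om_pow8 m
  rw [Kg, Matrix.det_smul, Matrix.det_fin_two_of]
  simp only [Fintype.card_fin]
  linear_combination (-1 - ω ^ m * ω ^ (7 * m)) * cc_sq + h8 / 2

lemma Kg_mul4 (m : ℕ) : Kg m * Kg (m + 4) = !![0, ω ^ m; -ω ^ (7 * m), 0] := by
  have h8 := om_pow8 m
  have e1 : ω ^ (m + 4) = -ω ^ m := by rw [pow_add, om4]; ring
  have e2 : ω ^ (7 * (m + 4)) = -ω ^ (7 * m) := by
    rw [show 7 * (m + 4) = 7 * m + 8 * 3 + 4 by ring, pow_add, pow_add, om4, pow_mul ω 8, om8]; ring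
  rw [Kg, Kg, Matrix.smul_mul, Matrix.mul_smul, smul_smul, cc_sq, e1, e2]
  ext i j
  fin_cases i <;> fin_cases j <;> simp [Matrix.mul_apply, Fin.sum_univ_two]
  · linear_combination -h8
  · ring
  · ring
  · linear_combination -h8

lemma Kg_entry (m : ℕ) (i j : Fin 2) : Kg m i j ∈ Dom := by
  have hc : Complex.I * ((Real.sqrt 2 : ℂ))⁻¹ ∈ Dom := mul_mem (Zom_le I_mem) inv_sq2_Dom
  have h1 := pow_mem (Zom_le om_mem) m
  have h2 := pow_mem (Zom_le om_mem) (7 * m)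
  rw [Kg, Matrix.smul_apply, smul_eq_mul]
  refine mul_mem hc ?_
  fin_cases i <;> fin_cases j
  · exact one_mem _
  · exact h1
  · exact h2
  · exact neg_mem (one_mem _)

/-- A matrix underlying an element of the subgroup `G` of the unitary group. -/
def InG (G : Subgroup (Matrix.unitaryGroup ι ℂ)) (M : Matrix ι ι ℂ) : Prop :=
  ∃ V ∈ G, (V : Matrix ι ι ℂ) = M

variable {G : Subgroup (Matrix.unitaryGroup ι ℂ)}

lemma InG.one : InG G 1 := ⟨1, one_mem _, rfl⟩

lemma InG.mul {M N : Matrix ι ι ℂ} (hM : InG G M) (hN : InG G N) : InG G (M * N) := by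
  obtain ⟨V, hV, rfl⟩ := hM
  obtain ⟨W, hW, rfl⟩ := hN
  exact ⟨V * W, mul_mem hV hW, rfl⟩

lemma InG.star {M : Matrix ι ι ℂ} (hM : InG G M) : InG G (star M) := by
  obtain ⟨V, hV, rfl⟩ := hM
  exact ⟨V⁻¹, inv_mem hV, rfl⟩

lemma InG.unitary {M : Matrix ι ι ℂ} (hM : InG G M) : M ∈ Matrix.unitaryGroup ι ℂ := by
  obtain ⟨V, hV, rfl⟩ := hM
  exact V.2

/-- Operators in `G`, of determinant one, with entries in `𝔻[ω]`, and supported on `s`. -/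
structure Qs (G : Subgroup (Matrix.unitaryGroup ι ℂ)) (s : Finset ι) (g : Matrix ι ι ℂ) : Prop where
  inG : InG G g
  det : g.det = 1
  ent : ∀ i j, g i j ∈ Dom
  fix : ∀ i, i ∉ s → g *ᵥ Pi.single i 1 = Pi.single i 1

lemma mul_ent {M N : Matrix ι ι ℂ} (hM : ∀ i j, M i j ∈ Dom) (hN : ∀ i j, N i j ∈ Dom) :
    ∀ i j, (M * N) i j ∈ Dom := fun i j => by
  rw [Matrix.mul_apply]; exact sum_mem fun k _ => mul_mem (hM i k) (hN k j)

lemma Qs.mul {s : Finset ι} {g h : Matrix ι ι ℂ} (hg : Qs G s g) (hh : Qs G s h) :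
    Qs G s (g * h) :=
  ⟨hg.inG.mul hh.inG, by rw [Matrix.det_mul, hg.det, hh.det, one_mul], mul_ent hg.ent hh.ent,
    fun i hi => by rw [← Matrix.mulVec_mulVec, hh.fix i hi, hg.fix i hi]⟩

lemma Qs.Kg {s : Finset ι} (hG : ∀ x y : ι, x ≠ y → ∀ m, InG G (tl x y (Kg m)))
    {x y : ι} (hx : x ∈ s) (hy : y ∈ s) (h : x ≠ y) (m : ℕ) : Qs G s (tl x y (_root_.Kg m)) := by
  refine ⟨hG x y h m, by rw [tl_det h, Kg_det], fun i j => ?_, fun i hi => ?_⟩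
  · have e : tl x y (_root_.Kg m) i j = (tl x y (_root_.Kg m) *ᵥ Pi.single j 1) i := by
      rw [Matrix.mulVec_single_one]; rfl
    have hs : ∀ k, (Pi.single j 1 : ι → ℂ) k ∈ Dom := fun k => by
      rw [Pi.single_apply]; split_ifs
      · exact one_mem _
      · exact zero_mem _
    rw [e, tl_mulVec h]
    split_ifs
    · exact add_mem (mul_mem (Kg_entry _ _ _) (hs _)) (mul_mem (Kg_entry _ _ _) (hs _))
    · exact add_mem (mul_mem (Kg_entry _ _ _) (hs _)) (mul_mem (Kg_entry _ _ _) (hs _))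
    · exact hs _
  · have hxi : x ≠ i := fun e => hi (e ▸ hx)
    have hyi : y ≠ i := fun e => hi (e ▸ hy)
    funext k
    rw [tl_mulVec h]
    split_ifs with h1 h2
    · subst h1; simp [Pi.single_eq_of_ne hxi, Pi.single_eq_of_ne hyi]
    · subst h2; simp [Pi.single_eq_of_ne hxi, Pi.single_eq_of_ne hyi]
    · rfl

lemma Qs.Wg {s : Finset ι} (hG : ∀ x y : ι, x ≠ y → ∀ m, InG G (tl x y (_root_.Kg m)))
    {x y : ι} (hx : x ∈ s) (hy : y ∈ s) (h : x ≠ y) (m : ℕ) :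
    Qs G s (tl x y !![0, ω ^ m; -ω ^ (7 * m), 0]) := by
  rw [← Kg_mul4, ← tl_mul h]
  exact (Qs.Kg hG hx hy h m).mul (Qs.Kg hG hx hy h _)

lemma norm_pres {g : Matrix ι ι ℂ} (hg : g ∈ Matrix.unitaryGroup ι ℂ) (v : ι → ℂ) :
    ∑ i, star ((g *ᵥ v) i) * (g *ᵥ v) i = ∑ i, star (v i) * v i := by
  have h1 : ∀ w : ι → ℂ, ∑ i, star (w i) * w i = star w ⬝ᵥ w := fun w => rfl
  rw [h1, h1, Matrix.star_mulVec, Matrix.dotProduct_mulVec, Matrix.vecMul_vecMul,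
    ← Matrix.star_eq_conjTranspose, Matrix.mem_unitaryGroup_iff'.1 hg, Matrix.vecMul_one]

/-- moving `ω^m e_b` to `e_a` for `b ≠ a`. -/
lemma W_move {a b : ι} (h : a ≠ b) (m : ℕ) :
    tl a b !![0, ω ^ (7 * m); -ω ^ (7 * (7 * m)), 0] *ᵥ Pi.single b (ω ^ m) = Pi.single a 1 := by
  funext k
  rw [tl_mulVec h]
  split_ifs with h1 h2
  · subst h1; have h8 := om_pow8 m; simp; linear_combination h8
  · subst h2; simp [Pi.single_eq_of_ne h, Pi.single_eq_of_ne h.symm]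
  · simp [Pi.single_eq_of_ne h1, Pi.single_eq_of_ne h2]

lemma red_zero {s : Finset ι} (hG : ∀ x y : ι, x ≠ y → ∀ m, InG G (tl x y (Kg m)))
    {a c : ι} (ha : a ∈ s) (hc : c ∈ s) (hac : a ≠ c) {b : ι} (hb : b ∈ s) (m : ℕ) :
    ∃ g, Qs G s g ∧ g *ᵥ Pi.single b (ω ^ m) = Pi.single a 1 := by
  by_cases hab : a = b
  · subst hab
    refine ⟨_, (Qs.Wg hG ha hc hac (7 * 0)).mul (Qs.Wg hG hc ha hac.symm (7 * m)), ?_⟩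
    rw [← Matrix.mulVec_mulVec, W_move hac.symm]
    have := W_move hac 0
    simpa using this
  · exact ⟨_, Qs.Wg hG ha hb hab (7 * m), W_move hab m⟩

/-- Reduction of a unit vector over `𝔻[ω]` supported on `s` to a basis vector. -/
lemma red {s : Finset ι} (hG : ∀ x y : ι, x ≠ y → ∀ m, InG G (tl x y (Kg m)))
    {a c : ι} (ha : a ∈ s) (hc : c ∈ s) (hac : a ≠ c) (l : ℕ) :
    ∀ v : ι → ℂ, (∀ i, i ∉ s → v i = 0) → ∑ i, star (v i) * v i = 1 →
      (∀ i, del ^ l * v i ∈ Zom) → ∃ g, Qs G s g ∧ g *ᵥ v = Pi.single a 1 := by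
  induction l with
  | zero =>
    intro v hs hn hv
    obtain ⟨b, m, rfl⟩ := unit_vec v (fun i => by simpa using hv i) hn
    have hb : b ∈ s := by
      by_contra hb
      have := hs b hb
      rw [Pi.single_eq_same] at this
      exact pow_ne_zero m om_ne this
    exact red_zero hG ha hc hac hb m
  | succ l ih =>
    classical
    suffices H : ∀ k : ℕ, ∀ v : ι → ℂ, (∀ i, i ∉ s → v i = 0) → ∑ i, star (v i) * v i = 1 →
        (∀ i, del ^ (l + 1) * v i ∈ Zom) →
        (Finset.univ.filter fun i => del ^ l * v i ∉ Zom).card ≤ k →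
        ∃ g, Qs G s g ∧ g *ᵥ v = Pi.single a 1 by
      intro v h1 h2 h3
      exact H _ v h1 h2 h3 le_rfl
    intro k
    induction k with
    | zero =>
      intro v h1 h2 h3 h4
      refine ih v h1 h2 fun i => ?_
      have h5 := Finset.card_eq_zero.1 (Nat.le_zero.1 h4)
      by_contra hi
      have : i ∈ (Finset.univ.filter fun i => del ^ l * v i ∉ Zom) := by simp [hi]
      rw [h5] at this
      simp at this
    | succ k ihk =>
      intro v h1 h2 h3 h4
      have hdiv : ∀ i, del ^ (l + 1) * v i / del = del ^ l * v i := fun i => by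
        have := del_ne
        rw [pow_succ]
        field_simp
      by_cases hall : ∀ i, del ^ l * v i ∈ Zom
      · exact ih v h1 h2 hall
      push Not at hall
      obtain ⟨x, hx⟩ := hall
      -- a second odd entry
      obtain ⟨y, hyx, hy⟩ : ∃ y, y ≠ x ∧ del ^ l * v y ∉ Zom := by
        by_contra hcon
        push Not at hcon
        have hx1 := odd_norm (h3 x) (by rw [hdiv]; exact hx)
        apply inv_del_notMem
        have hsum : ∑ i, star (del ^ (l + 1) * v i) * (del ^ (l + 1) * v i)
            = star (del ^ (l + 1)) * del ^ (l + 1) := by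
          rw [← mul_one (star (del ^ (l + 1)) * del ^ (l + 1)), ← h2, Finset.mul_sum]
          refine Finset.sum_congr rfl fun i _ => ?_
          rw [star_mul']; ring
        rw [← Finset.add_sum_erase _ _ (Finset.mem_univ x)] at hsum
        have e : 1 / del = star (del ^ (l + 1)) * del ^ l
            - (∑ i ∈ Finset.univ.erase x, star (del ^ (l + 1) * v i) * (del ^ l * v i))
            - (star (del ^ (l + 1) * v x) * (del ^ (l + 1) * v x) - 1) / del := by
          have e2 : (∑ i ∈ Finset.univ.erase x, star (del ^ (l + 1) * v i) * (del ^ l * v i))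
              = (∑ i ∈ Finset.univ.erase x,
                  star (del ^ (l + 1) * v i) * (del ^ (l + 1) * v i)) / del := by
            rw [Finset.sum_div]
            refine Finset.sum_congr rfl fun i _ => ?_
            rw [mul_div_assoc, hdiv]
          rw [e2, eq_sub_of_add_eq' hsum]
          have := del_ne
          field_simp
          ring
        rw [e]
        refine sub_mem (sub_mem (mul_mem (star_mem_Zom (pow_mem del_mem _)) (pow_mem del_mem _))
          (sum_mem fun i hi => mul_mem (star_mem_Zom (h3 i)) (hcon i ?_))) hx1
        exact (Finset.mem_erase.1 hi).1
      have hxs : x ∈ s := by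
        by_contra hcon; apply hx; rw [h1 x hcon, mul_zero]; exact zero_mem _
      have hys : y ∈ s := by
        by_contra hcon; apply hy; rw [h1 y hcon, mul_zero]; exact zero_mem _
      obtain ⟨m, hm⟩ := odd_pair (h3 x) (h3 y) (by rw [hdiv]; exact hx) (by rw [hdiv]; exact hy)
      have hm2 : (del ^ (l + 1) * v x - ω ^ m * (del ^ (l + 1) * v y)) / ((Real.sqrt 2 : ℂ) * del)
          ∈ Zom := by
        have : (del ^ (l + 1) * v x - ω ^ m * (del ^ (l + 1) * v y)) / ((Real.sqrt 2 : ℂ) * del)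
          = (del ^ (l + 1) * v x + ω ^ m * (del ^ (l + 1) * v y)) / ((Real.sqrt 2 : ℂ) * del)
            - 2 / ((Real.sqrt 2 : ℂ) * del) * (ω ^ m * (del ^ (l + 1) * v y)) := by ring
        rw [this]
        exact sub_mem hm (mul_mem two_div_sd (mul_mem (pow_mem om_mem _) (h3 y)))
      have hq := Qs.Kg hG hxs hys hyx.symm m
      set g := tl x y (Kg m) with hg
      have hgv : ∀ i, (g *ᵥ v) i = if i = x then Kg m 0 0 * v x + Kg m 0 1 * v y
          else if i = y then Kg m 1 0 * v x + Kg m 1 1 * v y else v i :=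
        fun i => tl_mulVec hyx.symm _ _ i
      have hgx : del ^ l * (g *ᵥ v) x ∈ Zom := by
        have : del ^ l * (g *ᵥ v) x = Complex.I *
            ((del ^ (l + 1) * v x + ω ^ m * (del ^ (l + 1) * v y)) / ((Real.sqrt 2 : ℂ) * del)) := by
          rw [hgv, if_pos rfl]
          have := del_ne; have := sq2_ne
          simp [Kg]
          rw [pow_succ]
          field_simp
        rw [this]; exact mul_mem I_mem hm
      have hgy : del ^ l * (g *ᵥ v) y ∈ Zom := by
        have : del ^ l * (g *ᵥ v) y = Complex.I * ω ^ (7 * m) *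
            ((del ^ (l + 1) * v x - ω ^ m * (del ^ (l + 1) * v y)) / ((Real.sqrt 2 : ℂ) * del)) := by
          rw [hgv, if_neg hyx, if_pos rfl]
          have := del_ne; have := sq2_ne
          have h8 := om_pow8 m
          simp [Kg]
          rw [pow_succ]
          field_simp
          linear_combination v y * h8
        rw [this]; exact mul_mem (mul_mem I_mem (pow_mem om_mem _)) hm2
      have hgo : ∀ i, i ≠ x → i ≠ y → (g *ᵥ v) i = v i := fun i h h' => by
        rw [hgv, if_neg h, if_neg h']
      obtain ⟨g', hg', hgv'⟩ := ihk (g *ᵥ v)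
        (fun i hi => by
          rw [hgo i (fun e => hi (e ▸ hxs)) (fun e => hi (e ▸ hys))]; exact h1 i hi)
        (by rw [norm_pres hq.inG.unitary, h2])
        (fun i => by
          by_cases hix : i = x
          · subst hix; rw [pow_succ', mul_assoc]; exact mul_mem del_mem hgx
          · by_cases hiy : i = y
            · subst hiy; rw [pow_succ', mul_assoc]; exact mul_mem del_mem hgy
            · rw [hgo i hix hiy]; exact h3 i)
        (by
          refine Nat.le_of_lt_succ (lt_of_lt_of_le (Finset.card_lt_card ?_) h4)
          refine (Finset.ssubset_iff_of_subset fun i hi => ?_).2 ⟨x, by simp [hx], by simp [hgx]⟩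
          simp only [Finset.mem_filter, Finset.mem_univ, true_and] at hi ⊢
          by_cases hix : i = x
          · subst hix; exact hx
          · by_cases hiy : i = y
            · subst hiy; exact hy
            · rwa [hgo i hix hiy] at hi)
      exact ⟨g' * g, hg'.mul hq, by rw [← Matrix.mulVec_mulVec, hgv']⟩

lemma common_den (v : ι → ℂ) (hv : ∀ i, v i ∈ Dom) : ∃ l : ℕ, ∀ i, del ^ l * v i ∈ Zom := by
  choose l hl using hv
  refine ⟨∑ i, l i, fun i => ?_⟩
  rw [← Finset.add_sum_erase _ _ (Finset.mem_univ i), pow_add,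
    mul_comm (del ^ l i), mul_assoc]
  exact mul_mem (pow_mem del_mem _) (hl i)

/-- Special unitary matrices over `𝔻[ω]` are generated by two-level operators. -/
lemma main_gen (hG : ∀ x y : ι, x ≠ y → ∀ m, InG G (tl x y (Kg m))) (s : Finset ι) :
    ∀ U : Matrix ι ι ℂ, U ∈ Matrix.unitaryGroup ι ℂ → (∀ i j, U i j ∈ Dom) → U.det = 1 →
      (∀ i, i ∉ s → U *ᵥ Pi.single i 1 = Pi.single i 1) → InG G U := by
  induction s using Finset.induction_on with
  | empty =>
    intro U _ _ _ h
    have : U = 1 := by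
      ext i j
      have := congrFun (h j (by simp)) i
      rw [Matrix.mulVec_single_one] at this
      rw [Matrix.one_apply, ← Pi.single_apply j (1 : ℂ) i]
      exact this
    rw [this]; exact InG.one
  | insert a s has ih =>
    intro U hU hE hdet hfix
    have hcol : ∀ i, i ∉ insert a s → ∀ k, U k i = (Pi.single i 1 : ι → ℂ) k := fun i hi k => by
      have := congrFun (hfix i hi) k
      rwa [Matrix.mulVec_single_one] at this
    have hsupp : ∀ i, i ∉ insert a s → U i a = 0 := by
      intro i hi
      have h1 := congrFun (congrFun (Matrix.mem_unitaryGroup_iff'.1 hU) i) a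
      have hia : i ≠ a := fun e => hi (e ▸ Finset.mem_insert_self _ _)
      rw [Matrix.mul_apply, Matrix.one_apply_ne hia] at h1
      simp only [Matrix.star_apply, hcol i hi, Pi.single_apply] at h1
      simpa using h1
    have hnorm : ∑ i, star (U i a) * U i a = 1 := by
      have h1 := congrFun (congrFun (Matrix.mem_unitaryGroup_iff'.1 hU) a) a
      rw [Matrix.mul_apply, Matrix.one_apply_eq] at h1
      simpa only [Matrix.star_apply] using h1
    by_cases hs : s = ∅
    · subst hs
      refine ih U hU hE hdet ?_
      have hdiag : U = Matrix.diagonal (fun i => U i i) := by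
        ext i j
        by_cases hij : i = j
        · subst hij; simp
        · rw [Matrix.diagonal_apply_ne _ hij]
          by_cases hj : j = a
          · subst hj; exact hsupp i (by simpa using hij)
          · rw [hcol j (by simpa using hj), Pi.single_eq_of_ne hij]
      have hd : ∏ i, U i i = 1 := by
        rw [hdiag, Matrix.det_diagonal] at hdet; exact hdet
      have haa : U a a = 1 := by
        have h := Finset.prod_eq_single (s := Finset.univ) (f := fun i => U i i) a
          (fun i _ hi => by
            show U i i = 1
            rw [hcol i (by simpa using hi), Pi.single_eq_same])
          (fun h => absurd (Finset.mem_univ a) h)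
        exact h.symm.trans hd
      intro i _
      by_cases hi : i = a
      · subst hi
        rw [Matrix.mulVec_single_one]
        funext k
        by_cases hk : k = i
        · subst hk; simpa using haa
        · rw [Pi.single_eq_of_ne hk]; exact hsupp k (by simpa using hk)
      · exact hfix i (by simpa using hi)
    · obtain ⟨c, hc⟩ := Finset.nonempty_iff_ne_empty.2 hs
      have hac : a ≠ c := fun e => has (e ▸ hc)
      obtain ⟨l, hl⟩ := common_den (fun i => U i a) fun i => hE i a
      obtain ⟨g, hg, hga⟩ := red (s := insert a s) hG (Finset.mem_insert_self a s)
        (Finset.mem_insert_of_mem hc) hac l (fun i => U i a) hsupp hnorm hl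
      have hgU : InG G (g * U) := by
        refine ih _ (mul_mem hg.inG.unitary hU) (mul_ent hg.ent hE)
          (by rw [Matrix.det_mul, hg.det, hdet, one_mul]) fun i hi => ?_
        rw [← Matrix.mulVec_mulVec]
        by_cases hia : i = a
        · subst hia
          rw [Matrix.mulVec_single_one, ← hga]; rfl
        · have hi' : i ∉ insert a s := by simp [hia, hi]
          rw [hfix i hi', hg.fix i hi']
      have : U = star g * (g * U) := by
        rw [← Matrix.mul_assoc, Matrix.mem_unitaryGroup_iff'.1 hg.inG.unitary, Matrix.one_mul]
      rw [this]
      exact hg.inG.star.mul hgU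

/-- Transitivity of the availability of two-level operators. -/
lemma tl_trans {x y z : ι} (hxy : x ≠ y) (hyz : y ≠ z) (hxz : x ≠ z)
    (h1 : ∀ m, InG G (tl x y (Kg m))) (h2 : ∀ m, InG G (tl y z (Kg m))) (m : ℕ) :
    InG G (tl x z (Kg m)) := by
  have hW : InG G (tl y z !![0, -1; 1, 0]) := by
    have e : (!![0, -1; 1, 0] : Matrix (Fin 2) (Fin 2) ℂ) = !![0, ω ^ 4; -ω ^ (7 * 4), 0] := by
      have : ω ^ (7 * 4) = -1 := by
        rw [show 7 * 4 = 8 * 3 + 4 by norm_num, pow_add, pow_mul, om8, om4]; norm_num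
      rw [this, om4]; simp
    rw [e, ← Kg_mul4, ← tl_mul hyz]
    exact (h2 _).mul (h2 _)
  have key : tl x z (Kg m) * tl y z !![0, -1; 1, 0] = tl y z !![0, -1; 1, 0] * tl x y (Kg m) := by
    refine mat_ext fun v i => ?_
    rw [← Matrix.mulVec_mulVec, ← Matrix.mulVec_mulVec, tl_mulVec hxz, tl_mulVec hyz]
    simp only [tl_mulVec hyz, tl_mulVec hxy]
    by_cases hix : i = x
    · subst hix; simp [hxy, hxz, hyz, hyz.symm, hxy.symm, hxz.symm]
    · by_cases hiy : i = y
      · subst hiy; simp [hyz, hyz.symm, hxy.symm, hxz.symm, hxz]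
      · by_cases hiz : i = z
        · subst hiz; simp [hxy, hxz, hyz, hyz.symm, hxy.symm, hxz.symm]
        · simp [hix, hiy, hiz]
  have : tl x z (Kg m) = tl y z !![0, -1; 1, 0] * tl x y (Kg m) * star (tl y z !![0, -1; 1, 0]) := by
    rw [← key, Matrix.mul_assoc, Matrix.mem_unitaryGroup_iff.1 hW.unitary, Matrix.mul_one]
  rw [this]
  exact (hW.mul (h1 m)).mul hW.star

end TwoLevel

/-! ### Block operators and multi-controlled gates -/

section Circuits

open scoped Matrix

variable {n : ℕ}

/-- The operator acting on qubit `j` by a matrix depending on the other qubits. -/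
def bd (j : Fin n) (f : (Fin n → Fin 2) → Matrix (Fin 2) (Fin 2) ℂ) :
    Matrix (Fin n → Fin 2) (Fin n → Fin 2) ℂ :=
  Matrix.of fun x y =>
    if ∀ i, i ≠ j → x i = y i then f (Function.update x j 0) (x j) (y j) else 0

lemma bd_mulVec (j : Fin n) (f : (Fin n → Fin 2) → Matrix (Fin 2) (Fin 2) ℂ)
    (v : (Fin n → Fin 2) → ℂ) (x : Fin n → Fin 2) :
    (bd j f *ᵥ v) x = f (Function.update x j 0) (x j) 0 * v (Function.update x j 0)
      + f (Function.update x j 0) (x j) 1 * v (Function.update x j 1) := by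
  have hne : Function.update x j (0 : Fin 2) ≠ Function.update x j 1 := by
    intro h
    have := congrFun h j
    simp at this
  rw [Matrix.mulVec, dotProduct]
  have hsub : ∑ y, bd j f x y * v y
      = ∑ y ∈ {Function.update x j (0 : Fin 2), Function.update x j 1}, bd j f x y * v y := by
    symm
    refine Finset.sum_subset (Finset.subset_univ _) fun y _ hy => ?_
    have : ¬ ∀ i, i ≠ j → x i = y i := by
      intro h
      apply hy
      have hy2 : y = Function.update x j (y j) := by
        funext i
        by_cases hi : i = j
        · subst hi; simp
        · rw [Function.update_of_ne hi, h i hi]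
      rw [hy2]
      rcases Fin.exists_fin_two.1 ⟨y j, rfl⟩ with h0 | h0 <;> simp [← h0]
    simp only [bd, Matrix.of_apply, if_neg this, zero_mul]
  rw [hsub, Finset.sum_pair hne]
  have h0 : ∀ b : Fin 2, ∀ i, i ≠ j → x i = Function.update x j b i := by
    intro b i hi
    rw [Function.update_of_ne hi]
  simp only [bd, Matrix.of_apply, if_pos (h0 _), Function.update_self]

lemma fin2_cases (a : Fin 2) : 0 = a ∨ 1 = a := by
  fin_cases a <;> simp

lemma bd_mul (j : Fin n) (f g : (Fin n → Fin 2) → Matrix (Fin 2) (Fin 2) ℂ) :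
    bd j f * bd j g = bd j fun c => f c * g c := by
  apply mat_ext
  intro v x
  rw [← Matrix.mulVec_mulVec]
  simp only [bd_mulVec, Function.update_idem, Function.update_self, Matrix.mul_apply,
    Fin.sum_univ_two]
  ring

lemma bd_star (j : Fin n) (f : (Fin n → Fin 2) → Matrix (Fin 2) (Fin 2) ℂ) :
    star (bd j f) = bd j fun c => star (f c) := by
  ext x y
  simp only [Matrix.star_apply, bd, Matrix.of_apply]
  by_cases h : ∀ i, i ≠ j → x i = y i
  · have h2 : ∀ i, i ≠ j → y i = x i := fun i hi => (h i hi).symm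
    have : Function.update y j (0 : Fin 2) = Function.update x j 0 := by
      funext i
      by_cases hi : i = j
      · subst hi; simp
      · simp [Function.update_of_ne hi, h i hi]
    rw [if_pos h, if_pos h2, this]
  · have h2 : ¬ ∀ i, i ≠ j → y i = x i := fun h2 => h fun i hi => (h2 i hi).symm
    rw [if_neg h, if_neg h2, star_zero]

lemma bd_smul_one (j : Fin n) (z : ℂ) : bd j (fun _ => z • 1) = z • 1 := by
  apply mat_ext
  intro v x
  rw [bd_mulVec, Matrix.smul_mulVec, Matrix.one_mulVec]
  rcases fin2_cases (x j) with h0 | h0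
  · have : Function.update x j 0 = x := by rw [h0, Function.update_eq_self]
    rw [this, ← h0]; simp
  · have : Function.update x j 1 = x := by rw [h0, Function.update_eq_self]
    rw [this, ← h0]; simp

lemma bd_one (j : Fin n) : bd j (fun _ => 1) = 1 := by
  have := bd_smul_one j 1
  simpa using this

lemma bd_unitary (j : Fin n) (f : (Fin n → Fin 2) → Matrix (Fin 2) (Fin 2) ℂ)
    (h : ∀ c, star (f c) * f c = 1) : bd j f ∈ Matrix.unitaryGroup (Fin n → Fin 2) ℂ := by
  rw [Matrix.mem_unitaryGroup_iff', bd_star, bd_mul]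
  simp only [h]
  exact bd_one j

lemma inv_sq2_sq : ((Real.sqrt 2 : ℂ))⁻¹ * ((Real.sqrt 2 : ℂ))⁻¹ = 1 / 2 := by
  rw [← mul_inv, sq2_mul]; norm_num

lemma star_inv_sq2 : star ((Real.sqrt 2 : ℂ))⁻¹ = ((Real.sqrt 2 : ℂ))⁻¹ := by
  simp

lemma H_star : star Hmat = Hmat := by
  ext i j
  fin_cases i <;> fin_cases j <;> simp [Hmat, Matrix.star_apply]

lemma H_sq : Hmat * Hmat = 1 := by
  ext i j
  have := inv_sq2_sq
  fin_cases i <;> fin_cases j <;>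
    simp [Hmat, Matrix.mul_apply, Fin.sum_univ_two] <;> linear_combination 2 * this

lemma S_star : star Smat = !![1, 0; 0, -Complex.I] := by
  ext i j
  fin_cases i <;> fin_cases j <;> simp [Smat, Matrix.star_apply]

lemma T_star : star Tmat = !![1, 0; 0, -ω ^ 3] := by
  ext i j
  have := star_om
  fin_cases i <;> fin_cases j <;> simp [Tmat, Matrix.star_apply] <;> simpa using this

lemma X_star : star Xmat = Xmat := by
  ext i j
  fin_cases i <;> fin_cases j <;> simp [Xmat, Matrix.star_apply]

lemma X_sq : Xmat * Xmat = 1 := by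
  ext i j
  fin_cases i <;> fin_cases j <;> simp [Xmat, Matrix.mul_apply, Fin.sum_univ_two]

lemma S_unit : star Smat * Smat = 1 := by
  rw [S_star]
  ext i j
  fin_cases i <;> fin_cases j <;> simp [Smat, Matrix.mul_apply, Fin.sum_univ_two]

lemma T_unit : star Tmat * Tmat = 1 := by
  rw [T_star]
  have := om4
  ext i j
  fin_cases i <;> fin_cases j <;> simp [Tmat, Matrix.mul_apply, Fin.sum_univ_two]
  linear_combination -this

lemma T_unit2 : Tmat * star Tmat = 1 := by
  rw [T_star]
  have := om4
  ext i j
  fin_cases i <;> fin_cases j <;> simp [Tmat, Matrix.mul_apply, Fin.sum_univ_two]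
  linear_combination -this

lemma X_eq : Hmat * (Smat * Smat) * Hmat = Xmat := by
  have := inv_sq2_sq
  ext i j
  fin_cases i <;> fin_cases j <;>
    simp [Hmat, Smat, Xmat, Matrix.mul_apply, Fin.sum_univ_two] <;>
    first | ring1 | linear_combination 2 * this

lemma mem_of_gen {M : Matrix (Fin n → Fin 2) (Fin n → Fin 2) ℂ}
    (hM : M ∈ Matrix.unitaryGroup (Fin n → Fin 2) ℂ)
    (h : M = ω • (1 : Matrix (Fin n → Fin 2) (Fin n → Fin 2) ℂ)
      ∨ (∃ j, M = app1 Hmat j) ∨ (∃ j, M = app1 Smat j) ∨ (∃ j, M = app1 Tmat j)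
      ∨ (∃ j l, j ≠ l ∧ M = app2 CNOTmat j l)) : InG (CliffordT n) M :=
  ⟨⟨M, hM⟩, Subgroup.subset_closure h, rfl⟩

/-- Uncontrolled availability of a one-qubit gate. -/
def U1 (j : Fin n) (A : Matrix (Fin 2) (Fin 2) ℂ) : Prop :=
  InG (CliffordT n) (bd j fun _ => A)

lemma U1.mul {j : Fin n} {A B : Matrix (Fin 2) (Fin 2) ℂ} (hA : U1 j A) (hB : U1 j B) :
    U1 j (A * B) := by
  have := InG.mul hA hB
  rw [bd_mul] at this
  exact this

lemma U1.star {j : Fin n} {A : Matrix (Fin 2) (Fin 2) ℂ} (hA : U1 j A) : U1 j (star A) := by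
  have := InG.star hA
  rw [bd_star] at this
  exact this

lemma U1_H (j : Fin n) : U1 j Hmat :=
  mem_of_gen (bd_unitary _ _ fun _ => by rw [H_star, H_sq]) (Or.inr (Or.inl ⟨j, rfl⟩))

lemma U1_S (j : Fin n) : U1 j Smat :=
  mem_of_gen (bd_unitary _ _ fun _ => S_unit) (Or.inr (Or.inr (Or.inl ⟨j, rfl⟩)))

lemma U1_T (j : Fin n) : U1 j Tmat :=
  mem_of_gen (bd_unitary _ _ fun _ => T_unit) (Or.inr (Or.inr (Or.inr (Or.inl ⟨j, rfl⟩))))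

lemma U1_X (j : Fin n) : U1 j Xmat := by
  rw [← X_eq]
  exact ((U1_H j).mul ((U1_S j).mul (U1_S j))).mul (U1_H j)

lemma U1_om (j : Fin n) : U1 j (ω • 1) := by
  refine mem_of_gen (bd_unitary _ _ fun _ => ?_) (Or.inl (bd_smul_one j ω))
  have h := star_om
  have h4 := om4
  rw [star_smul, star_one, smul_mul_smul_comm, h, mul_one]
  have : -ω ^ 3 * ω = 1 := by linear_combination -h4
  rw [this, one_smul]

lemma U1_iX (j : Fin n) : U1 j (Complex.I • Xmat) := by
  have := ((U1_om j).mul (U1_om j)).mul (U1_X j)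
  rw [smul_mul_smul_comm, mul_one, smul_mul_assoc, one_mul, ← sq, om_sq] at this
  exact this

/-- Availability of a gate on qubit `j` controlled on the qubits in `C` matching `p`. -/
def Ct (j : Fin n) (p : Fin n → Fin 2) (C : Finset (Fin n)) (A : Matrix (Fin 2) (Fin 2) ℂ) :
    Prop :=
  InG (CliffordT n) (bd j fun c => if ∀ i ∈ C, c i = p i then A else 1)

lemma Ct.star {j : Fin n} {p : Fin n → Fin 2} {C : Finset (Fin n)}
    {A : Matrix (Fin 2) (Fin 2) ℂ} (h : Ct j p C A) : Ct j p C (star A) := by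
  have := InG.star h
  rw [bd_star] at this
  unfold Ct
  convert this using 3
  split_ifs <;> simp

lemma Ct.conj {j : Fin n} {p : Fin n → Fin 2} {C : Finset (Fin n)}
    {A B : Matrix (Fin 2) (Fin 2) ℂ} (h : Ct j p C A) (hB : U1 j B) (hu : B * Star.star B = 1) :
    Ct j p C (B * A * Star.star B) := by
  have := InG.mul (InG.mul hB h) hB.star
  rw [bd_mul, bd_mul] at this
  unfold Ct
  convert this using 3
  split_ifs
  · rfl
  · rw [mul_one, hu]

lemma CNOT_eq {i j : Fin n} (hij : i ≠ j) :
    app2 CNOTmat i j = bd j fun c => if c i = 1 then Xmat else 1 := by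
  ext x y
  simp only [app2, bd, Matrix.of_apply, CNOTmat, Function.update_of_ne hij]
  by_cases h : ∀ k, k ≠ i → k ≠ j → x k = y k
  · rw [if_pos h]
    by_cases hi : x i = y i
    · have h2 : ∀ k, k ≠ j → x k = y k := by
        intro k hk
        by_cases hki : k = i
        · subst hki; exact hi
        · exact h k hki hk
      rw [if_pos h2, hi]
      generalize y i = a
      generalize x j = b
      generalize y j = c
      fin_cases a <;> fin_cases b <;> fin_cases c <;> simp [Xmat]
    · have h2 : ¬ ∀ k, k ≠ j → x k = y k := fun h2 => hi (h2 i hij)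
      rw [if_neg h2, if_neg fun e => hi e.1]
  · have h2 : ¬ ∀ k, k ≠ j → x k = y k := fun h2 => h fun k _ hk => h2 k hk
    rw [if_neg h, if_neg h2]

lemma Ct_single_X {i j : Fin n} (hij : i ≠ j) (p : Fin n → Fin 2) : Ct j p {i} Xmat := by
  have h1 : InG (CliffordT n) (bd j fun c => if c i = 1 then Xmat else 1) := by
    refine mem_of_gen (bd_unitary _ _ fun c => ?_)
      (Or.inr (Or.inr (Or.inr (Or.inr ⟨i, j, hij, (CNOT_eq hij).symm⟩))))
    split_ifs
    · rw [X_star, X_sq]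
    · simp
  unfold Ct
  simp only [Finset.mem_singleton, forall_eq]
  rcases fin2_cases (p i) with h0 | h0
  · have := InG.mul h1 (U1_X j)
    rw [bd_mul] at this
    convert this using 3 with c
    rw [← h0]
    generalize c i = a
    fin_cases a <;> simp [X_sq]
  · rw [← h0]; exact h1

/-- The diagonal gate `diag(ω⁻¹, ω)`. -/
def Dmat : Matrix (Fin 2) (Fin 2) ℂ := !![-ω ^ 3, 0; 0, ω]

lemma D_star : star Dmat = !![ω, 0; 0, -ω ^ 3] := by
  ext i j
  have h := star_om
  have h4 := om4
  fin_cases i <;> fin_cases j <;>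
    simp only [Dmat, Matrix.star_apply, star_neg, star_pow, star_zero, Matrix.of_apply,
      Matrix.cons_val', Matrix.cons_val_zero, Matrix.cons_val_one, Fin.zero_eta, Fin.mk_one,
      Fin.isValue, Matrix.cons_val_fin_one, h]
  linear_combination (ω ^ 5 - ω) * h4

lemma D_unit : Dmat * star Dmat = 1 := by
  rw [D_star]
  have h4 := om4
  ext i j
  fin_cases i <;> fin_cases j <;> simp [Dmat, Matrix.mul_apply, Fin.sum_univ_two] <;>
    linear_combination -h4

lemma TXTX : Tmat * Xmat * star Tmat * Xmat = Dmat := by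
  rw [T_star]
  ext i j
  fin_cases i <;> fin_cases j <;>
    simp [Dmat, Tmat, Xmat, Matrix.mul_apply, Fin.sum_univ_two]

lemma Ct_single_D {i j : Fin n} (hij : i ≠ j) (p : Fin n → Fin 2) : Ct j p {i} Dmat := by
  have hX := Ct_single_X hij p
  have hT := U1_T j
  have := InG.mul (InG.mul (InG.mul hT hX) hT.star) hX
  rw [bd_mul, bd_mul, bd_mul] at this
  unfold Ct
  convert this using 3
  split_ifs
  · rw [TXTX]
  · rw [mul_one, mul_one, T_unit2]

lemma DXDX : Dmat * (Complex.I • Xmat) * star Dmat * star (Complex.I • Xmat)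
    = !![-Complex.I, 0; 0, Complex.I] := by
  rw [D_star, star_smul, X_star]
  have h2 := om_sq
  have h4 := om4
  have hI := Complex.I_mul_I
  ext i j
  fin_cases i <;> fin_cases j <;>
    simp [Dmat, Xmat, Matrix.mul_apply, Fin.sum_univ_two]
  · linear_combination (ω ^ 2 * Complex.I) * h4 - Complex.I * h2 - hI
  · linear_combination (-ω ^ 2) * hI + h2

lemma HZH : Hmat * !![-Complex.I, 0; 0, Complex.I] * star Hmat = star (Complex.I • Xmat) := by
  rw [H_star, star_smul, X_star]
  have := inv_sq2_sq
  ext i j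
  fin_cases i <;> fin_cases j <;>
    simp [Hmat, Xmat, Matrix.mul_apply, Fin.sum_univ_two] <;>
    first | ring1 | linear_combination (-2 * Complex.I) * this

lemma Ct_iX (j : Fin n) (p : Fin n → Fin 2) (C : Finset (Fin n)) :
    j ∉ C → Ct j p C (Complex.I • Xmat) := by
  induction C using Finset.induction_on with
  | empty =>
    intro _
    have := U1_iX j
    unfold Ct
    unfold U1 at this
    simpa using this
  | insert i C hi ih =>
    intro hj
    have hij : i ≠ j := by
      rintro rfl
      exact hj (Finset.mem_insert_self _ _)
    have hX := ih fun h => hj (Finset.mem_insert_of_mem h)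
    have hD := Ct_single_D hij p
    have hZ : Ct j p (insert i C) !![-Complex.I, 0; 0, Complex.I] := by
      have := InG.mul (InG.mul (InG.mul hD hX) hD.star) hX.star
      rw [bd_mul, bd_mul, bd_mul] at this
      unfold Ct
      convert this using 3 with c
      have hsplit : (∀ k ∈ insert i C, c k = p k) ↔ c i = p i ∧ ∀ k ∈ C, c k = p k := by
        simp
      have hs1 : (∀ k ∈ ({i} : Finset (Fin n)), c k = p k) ↔ c i = p i := by simp
      have hXX : (Complex.I • Xmat) * star (Complex.I • Xmat) = 1 := by
        rw [star_smul, X_star, smul_mul_smul_comm, X_sq]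
        simp
      by_cases h1 : c i = p i
      · by_cases h2 : ∀ k ∈ C, c k = p k
        · rw [if_pos (hsplit.2 ⟨h1, h2⟩), if_pos (hs1.2 h1), if_pos h2, if_pos (hs1.2 h1),
            if_pos h2, DXDX]
        · rw [if_neg (fun h => h2 (hsplit.1 h).2), if_pos (hs1.2 h1), if_neg h2,
            if_pos (hs1.2 h1), if_neg h2, mul_one, mul_one, D_unit]
      · rw [if_neg (fun h => h1 (hsplit.1 h).1), if_neg (fun h => h1 (hs1.1 h)),
          if_neg (fun h => h1 (hs1.1 h))]
        split_ifs
        · rw [one_mul, mul_one, hXX]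
        · simp
    have := (hZ.conj (U1_H j) (by rw [H_star, H_sq])).star
    rw [HZH, star_star] at this
    exact this

lemma Kg_zero_eq : Smat * (Hmat * (Tmat * (Complex.I • Xmat) * star Tmat) * star Hmat) * star Smat
    = Kg 0 := by
  rw [S_star, H_star, T_star]
  have h := inv_sq2_sq
  have hs : ω - ω ^ 3 = (Real.sqrt 2 : ℂ) := sq2_eq.symm
  have h2 := om_sq
  have hI := Complex.I_mul_I
  have hne := sq2_ne
  have hk : ((Real.sqrt 2 : ℂ))⁻¹ * (Real.sqrt 2 : ℂ) = 1 := inv_mul_cancel₀ hne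
  have e3 : ω ^ 3 = Complex.I * ω := by rw [← h2]; ring
  have hw : ((Real.sqrt 2 : ℂ))⁻¹ * ((1 - Complex.I) * ω) = 1 := by
    have : (1 - Complex.I) * ω = (Real.sqrt 2 : ℂ) := by rw [← hs, e3]; ring
    rw [this, hk]
  ext i j
  fin_cases i <;> fin_cases j <;>
    simp [Kg, Hmat, Smat, Tmat, Xmat, Matrix.mul_apply, Fin.sum_univ_two, e3]
  · linear_combination (((Real.sqrt 2 : ℂ))⁻¹ * Complex.I) * hw
  · linear_combination (((Real.sqrt 2 : ℂ))⁻¹ * Complex.I) * hw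
      + (ω * ((Real.sqrt 2 : ℂ))⁻¹ ^ 2 - (1 + Complex.I) * ω * ((Real.sqrt 2 : ℂ))⁻¹ ^ 2) * hI
  · linear_combination ((Real.sqrt 2 : ℂ))⁻¹ * hw - ω * ((Real.sqrt 2 : ℂ))⁻¹ ^ 2 * hI
  · linear_combination (((Real.sqrt 2 : ℂ))⁻¹ * Complex.I) * hw
      + (Complex.I ^ 2 - Complex.I) * ω * ((Real.sqrt 2 : ℂ))⁻¹ ^ 2 * hI

lemma Kg_succ_eq (m : ℕ) : star Tmat * Kg m * star (star Tmat) = Kg (m + 1) := by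
  rw [star_star, T_star]
  have h4 := om4
  ext i j
  fin_cases i <;> fin_cases j <;>
    simp [Kg, Tmat, Matrix.mul_apply, Fin.sum_univ_two, pow_succ, mul_add]
  · ring
  · linear_combination (-Complex.I * ((Real.sqrt 2 : ℂ))⁻¹ * ω ^ (7 * m) * ω ^ 3) * h4
  · linear_combination (Complex.I * ((Real.sqrt 2 : ℂ))⁻¹) * h4

lemma Ct_Kg (j : Fin n) (p : Fin n → Fin 2) (C : Finset (Fin n)) (hj : j ∉ C) (m : ℕ) :
    Ct j p C (Kg m) := by
  induction m with
  | zero =>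
    have := (((Ct_iX j p C hj).conj (U1_T j) T_unit2).conj (U1_H j)
      (by rw [H_star, H_sq])).conj (U1_S j) (mul_eq_one_comm.1 S_unit)
    rw [Kg_zero_eq] at this
    exact this
  | succ m ih =>
    have := ih.conj (U1_T j).star (by rw [star_star]; exact T_unit)
    rw [Kg_succ_eq] at this
    exact this

lemma bd_eq_tl (j : Fin n) (p : Fin n → Fin 2) (A : Matrix (Fin 2) (Fin 2) ℂ) :
    bd j (fun c => if ∀ i ∈ Finset.univ.erase j, c i = p i then A else 1)
      = tl (Function.update p j 0) (Function.update p j 1) A := by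
  have hne : Function.update p j (0 : Fin 2) ≠ Function.update p j 1 := by
    intro h
    have := congrFun h j
    simp at this
  apply mat_ext
  intro v x
  rw [bd_mulVec, tl_mulVec hne]
  by_cases h : ∀ i, i ≠ j → x i = p i
  · have hx : ∀ b : Fin 2, Function.update x j b = Function.update p j b := by
      intro b
      funext i
      by_cases hi : i = j
      · subst hi; simp
      · simp [Function.update_of_ne hi, h i hi]
    have hc : ∀ i ∈ Finset.univ.erase j, Function.update x j 0 i = p i := by
      intro i hi
      have hi2 := Finset.ne_of_mem_erase hi
      rw [Function.update_of_ne hi2, h i hi2]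
    rw [if_pos hc, hx, hx]
    rcases fin2_cases (x j) with h0 | h0
    · have hx0 : x = Function.update p j 0 := by rw [← hx 0, h0, Function.update_eq_self]
      rw [if_pos hx0, ← h0]
    · have hx0 : x = Function.update p j 1 := by rw [← hx 1, h0, Function.update_eq_self]
      rw [if_neg (fun e => hne (e.symm.trans hx0)), if_pos hx0, ← h0]
  · have hc : ¬ ∀ i ∈ Finset.univ.erase j, Function.update x j 0 i = p i := by
      intro hc
      apply h
      intro i hi
      have := hc i (Finset.mem_erase.2 ⟨hi, Finset.mem_univ i⟩)
      rwa [Function.update_of_ne hi] at this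
    have hx : ∀ b : Fin 2, x ≠ Function.update p j b := by
      intro b e
      apply h
      intro i hi
      rw [e, Function.update_of_ne hi]
    rw [if_neg hc, if_neg (hx 0), if_neg (hx 1)]
    rcases fin2_cases (x j) with h0 | h0
    · have : Function.update x j 0 = x := by rw [h0, Function.update_eq_self]
      rw [this, ← h0]; simp
    · have : Function.update x j 1 = x := by rw [h0, Function.update_eq_self]
      rw [this, ← h0]; simp

lemma tl_swap {ι : Type*} [Fintype ι] [DecidableEq ι] {x y : ι} (h : x ≠ y)
    (A : Matrix (Fin 2) (Fin 2) ℂ) : tl x y (Xmat * A * star Xmat) = tl y x A := by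
  apply mat_ext
  intro v i
  rw [X_star, tl_mulVec h, tl_mulVec h.symm]
  simp only [Matrix.mul_apply, Fin.sum_univ_two]
  by_cases hx : i = x
  · have hy : i ≠ y := fun e => h (hx.symm.trans e)
    rw [if_pos hx, if_neg hy, if_pos hx]
    simp [Xmat]; ring
  · rw [if_neg hx, if_neg hx]
    split_ifs
    · simp [Xmat]; ring
    · rfl

lemma adj_mem (x : Fin n → Fin 2) (j : Fin n) (b : Fin 2) (hb : x ≠ Function.update x j b)
    (m : ℕ) : InG (CliffordT n) (tl x (Function.update x j b) (Kg m)) := by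
  have hK := Ct_Kg j x (Finset.univ.erase j) (Finset.notMem_erase _ _) m
  have hne : Function.update x j (0 : Fin 2) ≠ Function.update x j 1 := by
    intro h
    have := congrFun h j
    simp at this
  have hX := hK.conj (U1_X j) (by rw [X_star, X_sq])
  unfold Ct at hK hX
  rw [bd_eq_tl] at hK hX
  rw [tl_swap hne] at hX
  rcases fin2_cases (x j) with h0 | h0 <;>
    rcases fin2_cases b with h1 | h1
  · exact absurd (by rw [← h1, h0, Function.update_eq_self]) hb
  · have : Function.update x j 0 = x := by rw [h0, Function.update_eq_self]
    rw [this, h1] at hK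
    exact hK
  · have : Function.update x j 1 = x := by rw [h0, Function.update_eq_self]
    rw [this, h1] at hX
    exact hX
  · exact absurd (by rw [← h1, h0, Function.update_eq_self]) hb

lemma path_mem (x y : Fin n → Fin 2) (s : Finset (Fin n)) :
    x = s.piecewise y x ∨ ∀ m, InG (CliffordT n) (tl x (s.piecewise y x) (Kg m)) := by
  induction s using Finset.induction_on with
  | empty => left; simp
  | insert i s hi ih =>
    rw [Finset.piecewise_insert]
    set z := s.piecewise y x
    by_cases h1 : z = Function.update z i (y i)
    · rw [← h1]; exact ih
    · by_cases h2 : x = Function.update z i (y i)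
      · exact Or.inl h2
      · right
        by_cases h3 : x = z
        · rw [h3]
          exact adj_mem z i (y i) h1
        · exact tl_trans h3 h1 h2 (ih.resolve_left h3) (adj_mem z i (y i) h1)

lemma two_level_mem (x y : Fin n → Fin 2) (h : x ≠ y) (m : ℕ) :
    InG (CliffordT n) (tl x y (Kg m)) := by
  have := path_mem x y Finset.univ
  rw [Finset.piecewise_univ] at this
  exact this.resolve_left h m

end Circuits

/-- Every unitary `2^n × 2^n` matrix with entries in `𝔻[ω]` and determinant 1 belongs to
the Clifford+T group on `n` qubits (no ancillas). -/
theorem stmt11 (n : ℕ) (U : Matrix (Fin n → Fin 2) (Fin n → Fin 2) ℂ)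
    (hU : U ∈ Matrix.unitaryGroup (Fin n → Fin 2) ℂ)
    (hent : ∀ i j, inDω (U i j)) (hdet : U.det = 1) :
    ∃ V ∈ CliffordT n, (V : Matrix (Fin n → Fin 2) (Fin n → Fin 2) ℂ) = U :=
  main_gen (G := CliffordT n) two_level_mem Finset.univ U hU (fun i j => inDω_Dom (hent i j)) hdet
    fun i hi => absurd (Finset.mem_univ i) hi
end
end
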